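/- arXiv:2407.09878 — 3 statements merged into one kernel-verified Lean document; each statement's English description precedes it below -/
import Mathlib

section
/- Let T ⊂ ℝ² be a triangle with vertices in ℤ² whose sides have affine lengths a, b, c with gcd(a,b,c) = 1. Then X_T − E[X_T] has the same distribution as U_a + U_b + U_c + U_2 − E[U_a + U_b + U_c + U_2], where U_a, U_b, U_c, U_2 are independent and U_n is uniformly distributed on {0, 1, …, n−1}. -/
open MeasureTheory
open scoped ENNReal

noncomputable section

/-- The embedding of `ℤ²` into `ℝ²`. -/
def toR2 (m : ℤ × ℤ) : ℝ × ℝ := ((m.1 : ℝ), (m.2 : ℝ))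

/-- The cross product of two integer vectors. -/
def zcross (v w : ℤ × ℤ) : ℤ := v.1 * w.2 - v.2 * w.1

/-- `latCount C x = |(C + x) ∩ ℤ²|`, the number of lattice points in the translate `C + x`. -/
def latCount (C : Set (ℝ × ℝ)) (x : ℝ × ℝ) : ℕ :=
  Set.ncard {m : ℤ × ℤ | toR2 m - x ∈ C}

/-- The uniform distribution on the unit square `[0,1]²`. -/
def μunit : Measure (ℝ × ℝ) := volume.restrict (Set.Icc (0 : ℝ × ℝ) 1)

/-- The law (distribution on `ℝ`) of `U_a + U_b + U_c + U_2`, where `U_a, U_b, U_c, U_2` are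
independent and `U_n` is uniform on `{0, 1, …, n-1}`. -/
def lawS (a b c : ℕ) : Measure ℝ :=
  ((a : ℝ≥0∞) * b * c * 2)⁻¹ •
    ∑ k ∈ Finset.range a ×ˢ Finset.range b ×ˢ Finset.range c ×ˢ Finset.range 2,
      Measure.dirac ((k.1 : ℝ) + (k.2.1 : ℝ) + (k.2.2.1 : ℝ) + (k.2.2.2 : ℝ))

/-- The real functional `x ↦ v × x` attached to an integer vector `v`. -/
def rcross (v : ℤ × ℤ) (x : ℝ × ℝ) : ℝ := v.1 * x.2 - v.2 * x.1

lemma rcross_add (v : ℤ × ℤ) (x y : ℝ × ℝ) : rcross v (x + y) = rcross v x + rcross v y := by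
  simp only [rcross, Prod.fst_add, Prod.snd_add]; ring

lemma rcross_neg (v : ℤ × ℤ) (x : ℝ × ℝ) : rcross v (-x) = -rcross v x := by
  simp only [rcross, Prod.fst_neg, Prod.snd_neg]; ring

lemma rcross_toR2 (v m : ℤ × ℤ) : rcross v (toR2 m) = zcross v m := by
  simp [rcross, toR2, zcross]

lemma measurable_rcross (v : ℤ × ℤ) : Measurable (rcross v) := by
  unfold rcross; fun_prop

lemma ae_rcross_ne_intCast {v : ℤ × ℤ} (hv : v ≠ 0) :
    ∀ᵐ x : ℝ × ℝ, ∀ n : ℤ, rcross v x ≠ n := by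
  let L : ℝ × ℝ →ₗ[ℝ] ℝ :=
    (v.1 : ℝ) • LinearMap.snd ℝ ℝ ℝ - (v.2 : ℝ) • LinearMap.fst ℝ ℝ ℝ
  have hL : ∀ x, L x = rcross v x := fun x => by simp [L, rcross]
  have hne : L ≠ 0 := by
    intro h
    apply hv
    have h1 := hL (1, 0)
    have h2 := hL (0, 1)
    simp [h, rcross] at h1 h2
    exact Prod.ext (by exact_mod_cast h2.symm) h1
  have hs : Function.Surjective L := LinearMap.surjective hne
  have hc : (Set.range ((↑) : ℤ → ℝ)).Countable := Set.countable_range _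
  have := (ae_comp_linearMap_mem_iff L (volume : Measure (ℝ × ℝ)) (volume : Measure ℝ) hs
    hc.measurableSet.compl).2 (hc.ae_notMem _)
  filter_upwards [this] with x hx n hn
  exact hx ⟨n, by rw [hL, hn]⟩

lemma μunit_absolutelyContinuous : μunit ≪ (volume : Measure (ℝ × ℝ)) :=
  Measure.absolutelyContinuous_of_le Measure.restrict_le_self

/-- The projection of the plane to the torus. -/
def torusProj (x : ℝ × ℝ) : UnitAddCircle × UnitAddCircle :=
  ((x.1 : UnitAddCircle), (x.2 : UnitAddCircle))

lemma measurePreserving_torusProj : MeasurePreserving torusProj μunit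
    ((volume : Measure UnitAddCircle).prod volume) := by
  have h : μunit = (volume.restrict (Set.Ioc (0 : ℝ) (0 + 1))).prod
      (volume.restrict (Set.Ioc (0 : ℝ) (0 + 1))) := by
    rw [Measure.prod_restrict, μunit, ← Measure.volume_eq_prod]
    refine Measure.restrict_congr_set ?_
    have : Set.Icc (0 : ℝ × ℝ) 1 = Set.Icc 0 1 ×ˢ Set.Icc 0 1 := by
      rw [Set.Icc_prod_Icc]; rfl
    rw [this, Measure.volume_eq_prod, zero_add]
    exact (Measure.set_prod_ae_eq Ioc_ae_eq_Icc Ioc_ae_eq_Icc).symm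
  rw [h]
  exact (UnitAddCircle.measurePreserving_mk 0).prod (UnitAddCircle.measurePreserving_mk 0)

instance : IsProbabilityMeasure μunit where
  measure_univ := by
    rw [← Set.preimage_univ (f := torusProj),
      measurePreserving_torusProj.measure_preimage MeasurableSet.univ.nullMeasurableSet]
    simp [← Set.univ_prod_univ]

/-- A section of `torusProj`. -/
def torusSection (θ : UnitAddCircle × UnitAddCircle) : ℝ × ℝ :=
  ((AddCircle.equivIco 1 0 θ.1 : ℝ), (AddCircle.equivIco 1 0 θ.2 : ℝ))

lemma measurable_torusSection : Measurable torusSection := by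
  have : Measurable fun t : UnitAddCircle => (AddCircle.equivIco 1 0 t : ℝ) :=
    measurable_subtype_coe.comp (AddCircle.measurableEquivIco 1 0).measurable
  exact (this.comp measurable_fst).prodMk (this.comp measurable_snd)

lemma torusSection_torusProj (x : ℝ × ℝ) :
    torusSection (torusProj x) = x + toR2 (-⌊x.1⌋, -⌊x.2⌋) := by
  have h (t : ℝ) : (AddCircle.equivIco (1 : ℝ) 0 (t : UnitAddCircle) : ℝ) = t + -(⌊t⌋ : ℝ) := by
    have := AddCircle.coe_equivIco_mk_apply (p := (1 : ℝ)) t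
    rw [div_one, mul_one, ← Int.self_sub_floor] at this
    rw [← sub_eq_add_neg, ← this]
  ext <;> simp [torusSection, torusProj, h, toR2]

lemma torusProj_preimage {S : Set (ℝ × ℝ)}
    (hper : ∀ x (m : ℤ × ℤ), x + toR2 m ∈ S ↔ x ∈ S) :
    torusProj ⁻¹' (torusSection ⁻¹' S) = S := by
  ext x
  simp only [Set.mem_preimage, torusSection_torusProj, hper]

lemma μunit_preimage_add_right {S : Set (ℝ × ℝ)} (hS : MeasurableSet S)
    (hper : ∀ x (m : ℤ × ℤ), x + toR2 m ∈ S ↔ x ∈ S) (y : ℝ × ℝ) :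
    μunit ((· + y) ⁻¹' S) = μunit S := by
  have hS' := measurable_torusSection hS
  have h : (· + y) ⁻¹' S = torusProj ⁻¹' ((· + torusProj y) ⁻¹' (torusSection ⁻¹' S)) := by
    conv_lhs => rw [← torusProj_preimage hper]
    rfl
  rw [h, measurePreserving_torusProj.measure_preimage
    (measurable_add_const _ hS').nullMeasurableSet, measure_preimage_add_right,
    ← measurePreserving_torusProj.measure_preimage hS'.nullMeasurableSet,
    torusProj_preimage hper]

lemma μunit_preimage_neg {S : Set (ℝ × ℝ)} (hS : MeasurableSet S)
    (hper : ∀ x (m : ℤ × ℤ), x + toR2 m ∈ S ↔ x ∈ S) :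
    μunit (Neg.neg ⁻¹' S) = μunit S := by
  have hS' := measurable_torusSection hS
  have h : Neg.neg ⁻¹' S = torusProj ⁻¹' (Prod.map Neg.neg Neg.neg ⁻¹' (torusSection ⁻¹' S)) := by
    conv_lhs => rw [← torusProj_preimage hper]
    rfl
  rw [h, measurePreserving_torusProj.measure_preimage
    ((measurable_neg.prodMap measurable_neg) hS').nullMeasurableSet,
    ((Measure.measurePreserving_neg volume).prod
      (Measure.measurePreserving_neg volume)).measure_preimage hS'.nullMeasurableSet,
    ← measurePreserving_torusProj.measure_preimage hS'.nullMeasurableSet,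
    torusProj_preimage hper]

lemma map_eq_sum_dirac {Ω ι : Type*} [MeasurableSpace Ω] {μ : Measure Ω} {N : Ω → ℝ}
    (hN : Measurable N) (K : Finset ι) {cell : ι → Set Ω} {h : ι → ℝ}
    (hmeas : ∀ k ∈ K, MeasurableSet (cell k))
    (hdisj : (K : Set ι).PairwiseDisjoint cell)
    (hcover : ∀ᵐ x ∂μ, ∃ k ∈ K, x ∈ cell k)
    (hval : ∀ k ∈ K, ∀ x ∈ cell k, N x = h k) :
    μ.map N = ∑ k ∈ K, μ (cell k) • Measure.dirac (h k) := by
  ext s hs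
  rw [Measure.map_apply hN hs, Measure.finsetSum_apply]
  have h1 : N ⁻¹' s =ᵐ[μ] ⋃ k ∈ K, (N ⁻¹' s ∩ cell k) := by
    rw [Filter.eventuallyEq_set]
    filter_upwards [hcover] with x ⟨k, hk, hx⟩
    simp only [Set.mem_iUnion, Set.mem_inter_iff, exists_prop]
    exact ⟨fun hxs => ⟨k, hk, hxs, hx⟩, fun ⟨_, _, hxs, _⟩ => hxs⟩
  rw [measure_congr h1, measure_biUnion_finset
    (fun i hi j hj hij => (hdisj hi hj hij).mono Set.inter_subset_right Set.inter_subset_right)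
    (fun k hk => (hN hs).inter (hmeas k hk))]
  refine Finset.sum_congr rfl fun k hk => ?_
  rw [Measure.smul_apply, Measure.dirac_apply' _ hs, smul_eq_mul]
  by_cases hks : h k ∈ s
  · rw [Set.indicator_of_mem hks, Pi.one_apply, mul_one]
    congr 1
    exact Set.inter_eq_right.2 fun x hx => by rw [Set.mem_preimage, hval k hk x hx]; exact hks
  · rw [Set.indicator_of_notMem hks, mul_zero]
    convert measure_empty (μ := μ)
    refine Set.eq_empty_of_forall_notMem fun x ⟨hxs, hx⟩ => hks ?_
    rwa [← hval k hk x hx]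

/-- The set of points `x` at which the floors of `w₁ × x`, `w₂ × x`, `w₃ × x` have prescribed
residues modulo `a`, `b`, `c` and a prescribed sum. -/
def floorCell (w₁ w₂ w₃ : ℤ × ℤ) (a b c : ℕ) (A B C e : ℤ) : Set (ℝ × ℝ) :=
  {x | ⌊rcross w₁ x⌋ ≡ A [ZMOD a] ∧ ⌊rcross w₂ x⌋ ≡ B [ZMOD b] ∧ ⌊rcross w₃ x⌋ ≡ C [ZMOD c] ∧
    ⌊rcross w₁ x⌋ + ⌊rcross w₂ x⌋ + ⌊rcross w₃ x⌋ = -1 - e}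

lemma measurableSet_floorCell (w₁ w₂ w₃ : ℤ × ℤ) (a b c : ℕ) (A B C e : ℤ) :
    MeasurableSet (floorCell w₁ w₂ w₃ a b c A B C e) := by
  have hm (w : ℤ × ℤ) : Measurable fun x => ⌊rcross w x⌋ := (measurable_rcross w).floor
  have h : Measurable fun x => (⌊rcross w₁ x⌋, ⌊rcross w₂ x⌋, ⌊rcross w₃ x⌋) :=
    (hm w₁).prodMk ((hm w₂).prodMk (hm w₃))
  exact h (MeasurableSet.of_discrete (s := {l : ℤ × ℤ × ℤ | l.1 ≡ A [ZMOD a] ∧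
    l.2.1 ≡ B [ZMOD b] ∧ l.2.2 ≡ C [ZMOD c] ∧ l.1 + l.2.1 + l.2.2 = -1 - e}))

lemma add_mem_floorCell_iff {w₁ w₂ w₃ : ℤ × ℤ} {a b c : ℕ} {A B C e i j k : ℤ} {x y : ℝ × ℝ}
    (h₁ : rcross w₁ y = i) (h₂ : rcross w₂ y = j) (h₃ : rcross w₃ y = k) (hs : i + j + k = 0) :
    x + y ∈ floorCell w₁ w₂ w₃ a b c A B C e ↔
      x ∈ floorCell w₁ w₂ w₃ a b c (A - i) (B - j) (C - k) e := by
  have hmod (n l i A : ℤ) : l + i ≡ A [ZMOD n] ↔ l ≡ A - i [ZMOD n] := by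
    rw [Int.modEq_iff_dvd, Int.modEq_iff_dvd]
    ring_nf
  simp only [floorCell, Set.mem_ofPred_eq, rcross_add, h₁, h₂, h₃, Int.floor_add_intCast, hmod]
  have : ∀ l m n : ℤ, l + i + (m + j) + (n + k) = l + m + n := fun l m n => by linarith
  rw [this]

lemma rcross_eq_neg_sub {w₁ w₂ w₃ : ℤ × ℤ} (hw : w₁ + w₂ + w₃ = 0) (x : ℝ × ℝ) :
    rcross w₃ x = -rcross w₁ x - rcross w₂ x := by
  rw [add_eq_zero_iff_neg_eq] at hw
  subst hw
  simp [rcross]; ring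

section FloorLaw

variable {w₁ w₂ w₃ : ℤ × ℤ} {a b c : ℕ}

lemma add_toR2_mem_floorCell_iff (hw : w₁ + w₂ + w₃ = 0)
    (h₁ : ∃ ξ, w₁ = a • ξ) (h₂ : ∃ ξ, w₂ = b • ξ) (h₃ : ∃ ξ, w₃ = c • ξ)
    (A B C e : ℤ) (x : ℝ × ℝ) (m : ℤ × ℤ) :
    x + toR2 m ∈ floorCell w₁ w₂ w₃ a b c A B C e ↔ x ∈ floorCell w₁ w₂ w₃ a b c A B C e := by
  have hs : zcross w₁ m + zcross w₂ m + zcross w₃ m = 0 := by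
    have := rcross_eq_neg_sub hw (toR2 m)
    simp only [rcross_toR2] at this
    have : zcross w₃ m = -zcross w₁ m - zcross w₂ m := by exact_mod_cast this
    rw [this]; ring
  have hmod (n : ℕ) (w : ℤ × ℤ) (l A : ℤ) (h : ∃ ξ, w = n • ξ) :
      l ≡ A - zcross w m [ZMOD n] ↔ l ≡ A [ZMOD n] := by
    obtain ⟨ξ, rfl⟩ := h
    have : A - zcross (n • ξ) m ≡ A [ZMOD n] := by
      rw [Int.modEq_iff_dvd]
      exact ⟨zcross ξ m, by simp [zcross]; ring⟩
    exact ⟨fun h => h.trans this, fun h => h.trans this.symm⟩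
  rw [add_mem_floorCell_iff (rcross_toR2 _ _) (rcross_toR2 _ _) (rcross_toR2 _ _) hs]
  simp only [floorCell, Set.mem_ofPred_eq, hmod _ _ _ _ h₁, hmod _ _ _ _ h₂, hmod _ _ _ _ h₃]

lemma exists_rcross_eq (hw : zcross w₁ w₂ ≠ 0) (i j : ℝ) :
    ∃ y, rcross w₁ y = i ∧ rcross w₂ y = j := by
  have h : (w₁.1 * w₂.2 - w₁.2 * w₂.1 : ℝ) ≠ 0 := by exact_mod_cast hw
  refine ⟨((i * w₂.1 - j * w₁.1) / (w₁.1 * w₂.2 - w₁.2 * w₂.1),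
    (i * w₂.2 - j * w₁.2) / (w₁.1 * w₂.2 - w₁.2 * w₂.1)), ?_, ?_⟩ <;>
  · rw [rcross, ← mul_div_assoc, ← mul_div_assoc, ← sub_div, div_eq_iff h]
    ring

lemma exists_linear_comb_eq_one {a b c : ℕ} (h : Nat.gcd a (Nat.gcd b c) = 1) :
    ∃ x y z : ℤ, a * x + b * y + c * z = 1 := by
  have h1 := Nat.gcd_eq_gcd_ab a (Nat.gcd b c)
  rw [h, Nat.gcd_eq_gcd_ab b c] at h1
  refine ⟨a.gcdA (b.gcd c), b.gcdA c * a.gcdB (b.gcd c), b.gcdB c * a.gcdB (b.gcd c), ?_⟩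
  push_cast at h1
  linear_combination -h1

lemma μunit_floorCell_eq (hw : w₁ + w₂ + w₃ = 0) (hz : zcross w₁ w₂ ≠ 0)
    (h₁ : ∃ ξ, w₁ = a • ξ) (h₂ : ∃ ξ, w₂ = b • ξ) (h₃ : ∃ ξ, w₃ = c • ξ)
    (hgcd : Nat.gcd a (Nat.gcd b c) = 1) (A B C e : ℤ) :
    μunit (floorCell w₁ w₂ w₃ a b c A B C e) = μunit (floorCell w₁ w₂ w₃ a b c 0 0 0 e) := by
  obtain ⟨x, y, z, hxyz⟩ := exists_linear_comb_eq_one hgcd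
  let t := A + B + C
  obtain ⟨v, hv₁, hv₂⟩ :=
    exists_rcross_eq hz ((A - a * (x * t) : ℤ) : ℝ) ((B - b * (y * t) : ℤ) : ℝ)
  have hs : (A - a * (x * t)) + (B - b * (y * t)) + (C - c * (z * t)) = 0 := by
    simp only [t]
    linear_combination -(A + B + C) * hxyz
  have hv₃ : rcross w₃ v = ((C - c * (z * t) : ℤ) : ℝ) := by
    rw [rcross_eq_neg_sub hw, hv₁, hv₂, ← Int.cast_neg, ← Int.cast_sub]
    congr 1
    linarith
  rw [← μunit_preimage_add_right (measurableSet_floorCell ..)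
    (add_toR2_mem_floorCell_iff hw h₁ h₂ h₃ A B C e) v]
  congr 1
  ext u
  rw [Set.mem_preimage, add_mem_floorCell_iff hv₁ hv₂ hv₃ hs]
  have hmod (n : ℕ) (l A k : ℤ) : l ≡ A - (A - n * k) [ZMOD n] ↔ l ≡ 0 [ZMOD n] := by
    rw [sub_sub_cancel]
    have : n * k ≡ 0 [ZMOD n] := Int.modEq_zero_iff_dvd.2 ⟨k, rfl⟩
    exact ⟨fun h => h.trans this, fun h => h.trans this.symm⟩
  simp only [floorCell, Set.mem_ofPred_eq, hmod]

lemma ne_zero_of_zcross_ne_zero {v w : ℤ × ℤ} (h : zcross v w ≠ 0) : v ≠ 0 ∧ w ≠ 0 :=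
  ⟨by rintro rfl; simp [zcross] at h, by rintro rfl; simp [zcross] at h⟩

lemma zcross_right_eq {w₁ w₂ w₃ : ℤ × ℤ} (hw : w₁ + w₂ + w₃ = 0) : zcross w₂ w₃ = zcross w₁ w₂ := by
  rw [add_eq_zero_iff_neg_eq] at hw
  subst hw
  simp [zcross]; ring

/-- Away from a null set, none of the `wᵢ × x` is an integer. -/
lemma ae_forall_rcross_ne (hw : w₁ + w₂ + w₃ = 0) (hz : zcross w₁ w₂ ≠ 0) :
    ∀ᵐ x ∂μunit, ∀ n : ℤ, rcross w₁ x ≠ n ∧ rcross w₂ x ≠ n ∧ rcross w₃ x ≠ n := by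
  have h12 := ne_zero_of_zcross_ne_zero hz
  have h3 := (ne_zero_of_zcross_ne_zero ((zcross_right_eq hw).trans_ne hz)).2
  filter_upwards [μunit_absolutelyContinuous.ae_le (ae_rcross_ne_intCast h12.1),
    μunit_absolutelyContinuous.ae_le (ae_rcross_ne_intCast h12.2),
    μunit_absolutelyContinuous.ae_le (ae_rcross_ne_intCast h3)] with x h1 h2 h3 n
  exact ⟨h1 n, h2 n, h3 n⟩

lemma floor_neg_of_ne {t : ℝ} (ht : ∀ n : ℤ, t ≠ n) : ⌊-t⌋ = -1 - ⌊t⌋ := by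
  have h1 := Int.floor_le t
  have h2 := Int.lt_floor_add_one t
  rw [Int.floor_eq_iff]
  push_cast
  exact ⟨by linarith, by linarith [lt_of_le_of_ne h1 (ht _).symm]⟩

lemma μunit_floorCell_neg (hw : w₁ + w₂ + w₃ = 0) (hz : zcross w₁ w₂ ≠ 0)
    (h₁ : ∃ ξ, w₁ = a • ξ) (h₂ : ∃ ξ, w₂ = b • ξ) (h₃ : ∃ ξ, w₃ = c • ξ) (A B C e : ℤ) :
    μunit (floorCell w₁ w₂ w₃ a b c A B C e) =
      μunit (floorCell w₁ w₂ w₃ a b c (-1 - A) (-1 - B) (-1 - C) (1 - e)) := by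
  rw [← μunit_preimage_neg (measurableSet_floorCell ..)
    (add_toR2_mem_floorCell_iff hw h₁ h₂ h₃ A B C e)]
  refine measure_congr ?_
  rw [Filter.eventuallyEq_set]
  filter_upwards [ae_forall_rcross_ne hw hz] with x hx
  have hmod (n l A : ℤ) : -1 - l ≡ A [ZMOD n] ↔ l ≡ -1 - A [ZMOD n] := by
    rw [Int.modEq_iff_dvd, Int.modEq_iff_dvd, ← dvd_neg]
    ring_nf
  simp only [floorCell, Set.mem_preimage, Set.mem_ofPred_eq, rcross_neg,
    floor_neg_of_ne fun n => (hx n).1, floor_neg_of_ne fun n => (hx n).2.1,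
    floor_neg_of_ne fun n => (hx n).2.2, hmod]
  have : ∀ l m n : ℤ, (-1 - l + (-1 - m) + (-1 - n) = -1 - e) ↔ (l + m + n = -1 - (1 - e)) :=
    fun l m n => by omega
  rw [this]

lemma floor_add_floor_add_floor {r s t : ℝ} (h : r + s + t = 0) (hr : ∀ n : ℤ, r ≠ n) :
    ⌊r⌋ + ⌊s⌋ + ⌊t⌋ = -1 ∨ ⌊r⌋ + ⌊s⌋ + ⌊t⌋ = -2 := by
  have h1 : (⌊r⌋ : ℝ) < r := lt_of_le_of_ne (Int.floor_le r) (hr _).symm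
  have h2 : (⌊r⌋ + ⌊s⌋ + ⌊t⌋ : ℝ) < 0 := by linarith [Int.floor_le s, Int.floor_le t]
  have h3 : (-3 : ℝ) < ⌊r⌋ + ⌊s⌋ + ⌊t⌋ := by
    linarith [Int.lt_floor_add_one r, Int.lt_floor_add_one s, Int.lt_floor_add_one t]
  have h2' : ⌊r⌋ + ⌊s⌋ + ⌊t⌋ < 0 := by exact_mod_cast h2
  have h3' : -3 < ⌊r⌋ + ⌊s⌋ + ⌊t⌋ := by exact_mod_cast h3
  omega

/-- The integer-valued function which will turn out to have law `lawS a b c`. -/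
def floorStat (w₁ w₂ w₃ : ℤ × ℤ) (a b c : ℕ) (x : ℝ × ℝ) : ℤ :=
  ⌊rcross w₁ x⌋ % a + ⌊rcross w₂ x⌋ % b + ⌊rcross w₃ x⌋ % c +
    (-1 - (⌊rcross w₁ x⌋ + ⌊rcross w₂ x⌋ + ⌊rcross w₃ x⌋))

lemma measurable_floorStat (w₁ w₂ w₃ : ℤ × ℤ) (a b c : ℕ) :
    Measurable fun x => (floorStat w₁ w₂ w₃ a b c x : ℝ) := by
  have hm (w : ℤ × ℤ) : Measurable fun x => ⌊rcross w x⌋ := (measurable_rcross w).floor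
  have h : Measurable fun x => (⌊rcross w₁ x⌋, ⌊rcross w₂ x⌋, ⌊rcross w₃ x⌋) :=
    (hm w₁).prodMk ((hm w₂).prodMk (hm w₃))
  have hF : Measurable fun l : ℤ × ℤ × ℤ =>
    ((l.1 % a + l.2.1 % b + l.2.2 % c + (-1 - (l.1 + l.2.1 + l.2.2)) : ℤ) : ℝ) :=
    Measurable.of_discrete
  simpa only [floorStat] using! hF.comp h

theorem map_floorStat (ha : 0 < a) (hb : 0 < b) (hc : 0 < c)
    (hw : w₁ + w₂ + w₃ = 0) (hz : zcross w₁ w₂ ≠ 0)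
    (h₁ : ∃ ξ, w₁ = a • ξ) (h₂ : ∃ ξ, w₂ = b • ξ) (h₃ : ∃ ξ, w₃ = c • ξ)
    (hgcd : Nat.gcd a (Nat.gcd b c) = 1) :
    μunit.map (fun x => (floorStat w₁ w₂ w₃ a b c x : ℝ)) = lawS a b c := by
  let K := Finset.range a ×ˢ Finset.range b ×ˢ Finset.range c ×ˢ Finset.range 2
  let cell : ℕ × ℕ × ℕ × ℕ → Set (ℝ × ℝ) := fun k =>
    floorCell w₁ w₂ w₃ a b c k.1 k.2.1 k.2.2.1 k.2.2.2
  let h : ℕ × ℕ × ℕ × ℕ → ℝ := fun k => (k.1 : ℝ) + (k.2.1 : ℝ) + (k.2.2.1 : ℝ) + (k.2.2.2 : ℝ)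
  have hmod {n k : ℕ} {l : ℤ} (hk : k < n) : l ≡ k [ZMOD n] ↔ l % n = k := by
    rw [Int.ModEq, Int.emod_eq_of_lt (a := (k : ℤ)) (by positivity) (by exact_mod_cast hk)]
  have hmem {k} (hk : k ∈ K) (x) : x ∈ cell k ↔ ⌊rcross w₁ x⌋ % a = k.1 ∧
      ⌊rcross w₂ x⌋ % b = k.2.1 ∧ ⌊rcross w₃ x⌋ % c = k.2.2.1 ∧
      ⌊rcross w₁ x⌋ + ⌊rcross w₂ x⌋ + ⌊rcross w₃ x⌋ = -1 - k.2.2.2 := by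
    simp only [K, Finset.mem_product, Finset.mem_range] at hk
    simp only [cell, floorCell, Set.mem_ofPred_eq, hmod hk.1, hmod hk.2.1, hmod hk.2.2.1]
  have hdisj : (K : Set (ℕ × ℕ × ℕ × ℕ)).PairwiseDisjoint cell := by
    intro k hk l hl hkl
    refine Set.disjoint_left.2 fun x hxk hxl => hkl ?_
    obtain ⟨a1, a2, a3, a4⟩ := (hmem hk x).1 hxk
    obtain ⟨b1, b2, b3, b4⟩ := (hmem hl x).1 hxl
    ext <;> omega
  have hcover : ∀ᵐ x ∂μunit, ∃ k ∈ K, x ∈ cell k := by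
    filter_upwards [ae_forall_rcross_ne hw hz] with x hx
    have hnat (l : ℤ) {n : ℕ} (hn : 0 < n) : ∃ k < n, l % n = (k : ℤ) := by
      have hn' : (0 : ℤ) < n := by exact_mod_cast hn
      refine ⟨(l % n).toNat, ?_, ?_⟩
      · have := Int.emod_lt_of_pos l hn'
        omega
      · rw [Int.toNat_of_nonneg (Int.emod_nonneg l hn'.ne')]
    obtain ⟨i, hi, hi'⟩ := hnat ⌊rcross w₁ x⌋ ha
    obtain ⟨j, hj, hj'⟩ := hnat ⌊rcross w₂ x⌋ hb
    obtain ⟨k, hk, hk'⟩ := hnat ⌊rcross w₃ x⌋ hc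
    have he : ∃ e < 2, ⌊rcross w₁ x⌋ + ⌊rcross w₂ x⌋ + ⌊rcross w₃ x⌋ = -1 - ((e : ℕ) : ℤ) := by
      have hsum : rcross w₁ x + rcross w₂ x + rcross w₃ x = 0 := by
        rw [rcross_eq_neg_sub hw]; ring
      obtain h | h := floor_add_floor_add_floor hsum fun n => (hx n).1
      · exact ⟨0, by norm_num, by rw [h]; norm_num⟩
      · exact ⟨1, by norm_num, by rw [h]; norm_num⟩
    obtain ⟨e, he, he'⟩ := he
    have hk : (i, j, k, e) ∈ K := by
      simp only [K, Finset.mem_product, Finset.mem_range]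
      exact ⟨hi, hj, hk, he⟩
    exact ⟨_, hk, (hmem hk x).2 ⟨hi', hj', hk', he'⟩⟩
  have hmeas (k) : MeasurableSet (cell k) := measurableSet_floorCell ..
  have hconst : ∀ k ∈ K, μunit (cell k) = μunit (floorCell w₁ w₂ w₃ a b c 0 0 0 0) := by
    intro k hk
    simp only [K, Finset.mem_product, Finset.mem_range] at hk
    have heq := μunit_floorCell_eq hw hz h₁ h₂ h₃ hgcd
    simp only [cell]
    rw [heq]
    obtain h | h : k.2.2.2 = 0 ∨ k.2.2.2 = 1 := by omega
    · simp [h]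
    · rw [h, μunit_floorCell_neg hw hz h₁ h₂ h₃, heq]
      simp
  have hp : ((a : ℝ≥0∞) * b * c * 2) * μunit (floorCell w₁ w₂ w₃ a b c 0 0 0 0) = 1 := by
    have h1 : μunit (⋃ k ∈ K, cell k) = 1 := by
      rw [prob_compl_eq_zero_iff (K.measurableSet_biUnion fun k _ => hmeas k) |>.symm]
      filter_upwards [hcover] with x hx
      simpa using hx
    rw [measure_biUnion_finset hdisj fun k _ => hmeas k, Finset.sum_congr rfl hconst] at h1
    simpa [K, mul_assoc] using h1
  rw [map_eq_sum_dirac (measurable_floorStat ..) K (cell := cell) (h := h) (fun k _ => hmeas k)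
    hdisj hcover ?_, lawS, Finset.smul_sum]
  · refine Finset.sum_congr rfl fun k hk => ?_
    rw [hconst k hk, ENNReal.eq_inv_of_mul_eq_one_left ((mul_comm _ _).trans hp)]
  · intro k hk x hx
    obtain ⟨a1, a2, a3, a4⟩ := (hmem hk x).1 hx
    simp only [h, floorStat, a1, a2, a3, a4]
    push_cast
    ring

end FloorLaw

lemma sum_fract_add_div (n : ℕ) (hn : 0 < n) (s : ℝ) :
    ∑ j ∈ Finset.range n, Int.fract (s + j / n) = Int.fract (n * s) + (n - 1) / 2 := by
  have hn' : (0 : ℝ) < n := by exact_mod_cast hn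
  have hper : Function.Periodic
      (fun s : ℝ => ∑ j ∈ Finset.range n, Int.fract (s + j / n)) (1 / n : ℝ) := by
    intro s
    have h1 (j : ℕ) : s + 1 / n + j / n = s + ((j + 1 : ℕ) : ℝ) / n := by push_cast; ring
    simp only [h1]
    have h2 := Finset.sum_range_succ (fun j : ℕ => Int.fract (s + (j : ℝ) / n)) n
    rw [Finset.sum_range_succ', div_self hn'.ne', Int.fract_add_one] at h2
    simpa using h2
  have hs : s = Int.fract (n * s) / n + ⌊n * s⌋ • (1 / n : ℝ) := by
    have := Int.fract_add_floor (n * s)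
    rw [zsmul_eq_mul, mul_one_div, ← add_div, this, mul_div_cancel_left₀ _ hn'.ne']
  have key := hper.zsmul ⌊n * s⌋ (Int.fract (n * s) / n)
  simp only [← hs] at key
  rw [key]
  have h0 := Int.fract_nonneg (n * s)
  have h1 := Int.fract_lt_one (n * s)
  have hj : ∀ j ∈ Finset.range n,
      Int.fract (Int.fract (n * s) / n + (j : ℝ) / n) = Int.fract (n * s) / n + j / n := by
    intro j hj
    have hj' : (j : ℝ) + 1 ≤ n := by exact_mod_cast Finset.mem_range.1 hj
    rw [Int.fract_eq_self]
    refine ⟨by positivity, ?_⟩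
    rw [← add_div, div_lt_one hn']
    linarith
  rw [Finset.sum_congr rfl hj, Finset.sum_add_distrib, ← Finset.sum_div]
  have hg : ∑ j ∈ Finset.range n, (j : ℝ) = n * (n - 1) / 2 := by
    have h : (((∑ j ∈ Finset.range n, j) * 2 : ℕ) : ℝ) = (n * (n - 1) : ℕ) := by
      rw [Finset.sum_range_id_mul_two n]
    push_cast [Nat.cast_pred hn] at h
    linarith
  rw [← Finset.sum_div, hg]
  simp only [Finset.sum_const, Finset.card_range, nsmul_eq_mul]
  field_simp

/-- The linear map `(k, l) ↦ k v + l w`. -/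
def pairMap (v w : ℤ × ℤ) : ℤ × ℤ →ₗ[ℤ] ℤ × ℤ :=
  (LinearMap.toSpanSingleton ℤ _ v).coprod (LinearMap.toSpanSingleton ℤ _ w)

lemma pairMap_apply (v w k : ℤ × ℤ) : pairMap v w k = k.1 • v + k.2 • w := by
  simp [pairMap]

/-- The sublattice of `ℤ²` spanned by `v` and `w`. -/
abbrev pairLattice (v w : ℤ × ℤ) : Submodule ℤ (ℤ × ℤ) := LinearMap.range (pairMap v w)

lemma mem_pairLattice {v w m : ℤ × ℤ} : m ∈ pairLattice v w ↔ ∃ k l : ℤ, k • v + l • w = m := by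
  simp [pairLattice, LinearMap.mem_range, pairMap_apply]

lemma det_pairMap (v w : ℤ × ℤ) : LinearMap.det (pairMap v w) = zcross v w := by
  rw [← LinearMap.det_toMatrix (Module.Basis.finTwoProd ℤ), Matrix.det_fin_two]
  simp [LinearMap.toMatrix_apply, pairMap_apply, zcross, mul_comm]

lemma card_quotient_pairLattice {v w : ℤ × ℤ} (h : zcross v w ≠ 0) :
    Nat.card ((ℤ × ℤ) ⧸ pairLattice v w) = (zcross v w).natAbs := by
  have hinj : Function.Injective (pairMap v w) :=
    LinearMap.ker_eq_bot.1 <| by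
      by_contra hker
      exact h (det_pairMap v w ▸ LinearMap.det_eq_zero_iff_ker_ne_bot.2 hker)
  rw [← Submodule.natAbs_det_equiv _ (LinearEquiv.ofInjective _ hinj), ← det_pairMap]
  rfl

lemma sum_out_add {M : Submodule ℤ (ℤ × ℤ)} [Fintype ((ℤ × ℤ) ⧸ M)] {F : ℤ × ℤ → ℝ}
    (hF : ∀ m, ∀ k ∈ M, F (m + k) = F m) (m₀ : ℤ × ℤ) :
    ∑ g : (ℤ × ℤ) ⧸ M, F (g.out + m₀) = ∑ g : (ℤ × ℤ) ⧸ M, F g.out := by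
  have hout (m : ℤ × ℤ) : F m = F (Submodule.Quotient.mk (p := M) m).out := by
    have h : Submodule.Quotient.mk (p := M) (Submodule.Quotient.mk (p := M) m).out
        = Submodule.Quotient.mk m := Quotient.out_eq _
    rw [Submodule.Quotient.eq] at h
    rw [← hF m _ h, add_sub_cancel]
  rw [← Equiv.sum_comp (Equiv.addRight (Submodule.Quotient.mk (p := M) m₀))
    (fun g => F g.out)]
  refine Finset.sum_congr rfl fun g _ => ?_
  rw [hout, Submodule.Quotient.mk_add]
  have hg : Submodule.Quotient.mk (p := M) g.out = g := Quotient.out_eq g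
  rw [hg]
  rfl

lemma exists_zcross_eq_gcd (v : ℤ × ℤ) : ∃ m, zcross v m = Int.gcd v.1 v.2 := by
  refine ⟨(-Int.gcdB v.1 v.2, Int.gcdA v.1 v.2), ?_⟩
  rw [Int.gcd_eq_gcd_ab, zcross]
  ring

lemma gcd_dvd_zcross (v m : ℤ × ℤ) : (Int.gcd v.1 v.2 : ℤ) ∣ zcross v m :=
  dvd_sub (Dvd.dvd.mul_right (Int.gcd_dvd_left ..) _) (Dvd.dvd.mul_right (Int.gcd_dvd_right ..) _)

lemma zcross_add (v m k : ℤ × ℤ) : zcross v (m + k) = zcross v m + zcross v k := by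
  simp [zcross]; ring

lemma zcross_smul (v m : ℤ × ℤ) (k : ℤ) : zcross v (k • m) = k * zcross v m := by
  simp [zcross]; ring

lemma sum_fract_zcross {M : Submodule ℤ (ℤ × ℤ)} [Fintype ((ℤ × ℤ) ⧸ M)] {D : ℤ} (hD : D ≠ 0)
    (hcard : Fintype.card ((ℤ × ℤ) ⧸ M) = D.natAbs) {v : ℤ × ℤ}
    (hM : ∀ k ∈ M, D ∣ zcross v k) {a : ℕ} (ha : a = Int.gcd v.1 v.2) (haD : (a : ℤ) ∣ D)
    (p : ℤ × ℤ) :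
    ∃ κ : ℝ, ∀ ρ : ℝ, ∑ g : (ℤ × ℤ) ⧸ M, Int.fract ((zcross v (g.out - p) - ρ) / D)
      = a * Int.fract (-(D.sign * ρ / a)) + κ := by
  obtain ⟨n, hn⟩ := (Int.natCast_dvd.1 haD)
  have hpos : 0 < a * n := hn ▸ Int.natAbs_pos.2 hD
  have ha0 : (a : ℝ) ≠ 0 := by exact_mod_cast (pos_of_mul_pos_left hpos (Nat.zero_le _)).ne'
  have hn0 : 0 < n := pos_of_mul_pos_right hpos (Nat.zero_le _)
  have hn0' : (n : ℝ) ≠ 0 := by exact_mod_cast hn0.ne'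
  have hDs : (D : ℝ) = D.sign * (a * n) := by
    have := Int.sign_mul_natAbs D
    rw [hn] at this
    exact_mod_cast this.symm
  have hsign : (D.sign : ℝ) * D.sign = 1 := by
    obtain h | h := hD.lt_or_gt
    · simp [Int.sign_eq_neg_one_of_neg h]
    · simp [Int.sign_eq_one_of_pos h]
  have hs0 : (D.sign : ℝ) ≠ 0 := left_ne_zero_of_mul_eq_one hsign
  have hDR : (D : ℝ) ≠ 0 := by exact_mod_cast hD
  refine ⟨a * ((n - 1) / 2), fun ρ => ?_⟩
  set F : ℤ × ℤ → ℝ := fun m => Int.fract ((zcross v (m - p) - ρ) / D) with hFdef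
  have hF : ∀ m, ∀ k ∈ M, F (m + k) = F m := by
    intro m k hk
    obtain ⟨t, ht⟩ := hM k hk
    have : ((zcross v (m + k - p) - ρ) / D : ℝ) = (zcross v (m - p) - ρ) / D + t := by
      rw [show m + k - p = m - p + k by abel, zcross_add, ht]
      push_cast
      field_simp
      ring
    simp only [hFdef, this, Int.fract_add_intCast]
  obtain ⟨m₀, hm₀⟩ := exists_zcross_eq_gcd v
  rw [← ha] at hm₀
  have hshift (m : ℤ × ℤ) (j : ℕ) : F (m + ((j * D.sign : ℤ)) • m₀) =
      Int.fract ((zcross v (m - p) - ρ) / D + j / n) := by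
    have h2 : ((zcross v (m + ((j * D.sign : ℤ)) • m₀ - p) - ρ) / D : ℝ)
        = (zcross v (m - p) - ρ) / D + j / n := by
      rw [show m + ((j * D.sign : ℤ)) • m₀ - p = m - p + ((j * D.sign : ℤ)) • m₀ by abel,
        zcross_add, zcross_smul, hm₀, hDs]
      push_cast
      field_simp
      ring
    simp only [hFdef, h2]
  have hH (m : ℤ × ℤ) : Int.fract (n * ((zcross v (m - p) - ρ) / D : ℝ)) =
      Int.fract (-(D.sign * ρ / a)) := by
    obtain ⟨t, ht⟩ := gcd_dvd_zcross v (m - p)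
    rw [← ha] at ht
    have : (n * ((zcross v (m - p) - ρ) / D) : ℝ) =
        -(D.sign * ρ / a) + ((D.sign * t : ℤ) : ℝ) := by
      rw [ht, hDs]
      push_cast
      field_simp
      linear_combination (a * t - ρ) * (-hsign)
    rw [this, Int.fract_add_intCast]
  have hsum : (n : ℝ) * ∑ g : (ℤ × ℤ) ⧸ M, F g.out =
      (a * n : ℝ) * (Int.fract (-(D.sign * ρ / a)) + (n - 1) / 2) := by
    calc (n : ℝ) * ∑ g : (ℤ × ℤ) ⧸ M, F g.out
        = ∑ j ∈ Finset.range n, ∑ g : (ℤ × ℤ) ⧸ M, F (g.out + ((j * D.sign : ℤ)) • m₀) := by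
          simp only [sum_out_add hF, Finset.sum_const, Finset.card_range, nsmul_eq_mul]
      _ = ∑ g : (ℤ × ℤ) ⧸ M, (Int.fract (-(D.sign * ρ / a)) + (n - 1) / 2) := by
          rw [Finset.sum_comm]
          refine Finset.sum_congr rfl fun g _ => ?_
          simp only [hshift]
          rw [sum_fract_add_div n hn0, hH]
      _ = _ := by
          rw [Finset.sum_const, Finset.card_univ, hcard, hn, nsmul_eq_mul]
          push_cast
          ring
  refine mul_left_cancel₀ hn0' ?_
  rw [hsum]
  ring

/-- The barycentric-type coordinate of the lattice point `m`, relative to the triangle translated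
by `x`, attached to the edge with direction `v` starting at `p`. -/
def edgeCoord (D : ℤ) (v p : ℤ × ℤ) (x : ℝ × ℝ) (m : ℤ × ℤ) : ℝ :=
  (zcross v (m - p) - rcross v x) / D

lemma edgeCoord_add {D : ℤ} (hD : D ≠ 0) {v k : ℤ × ℤ} {l : ℤ} (hk : zcross v k = l * D)
    (p : ℤ × ℤ) (x : ℝ × ℝ) (m : ℤ × ℤ) : edgeCoord D v p x (m + k) = edgeCoord D v p x m + l := by
  have hD' : (D : ℝ) ≠ 0 := by exact_mod_cast hD
  rw [edgeCoord, edgeCoord, show m + k - p = m - p + k by abel, zcross_add, hk]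
  push_cast
  field_simp
  ring

lemma edgeCoord_ne_intCast {D : ℤ} (hD : D ≠ 0) {v : ℤ × ℤ} {x : ℝ × ℝ}
    (hx : ∀ n : ℤ, rcross v x ≠ n) (p m : ℤ × ℤ) (n : ℤ) : edgeCoord D v p x m ≠ n := by
  have hD' : (D : ℝ) ≠ 0 := by exact_mod_cast hD
  rw [edgeCoord, Ne, div_eq_iff hD']
  intro h
  apply hx (zcross v (m - p) - n * D)
  push_cast
  linarith

lemma edgeCoord_sum {D : ℤ} (hD : D ≠ 0) {p q r : ℤ × ℤ} (hDdef : D = zcross (q - p) (r - q))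
    (x : ℝ × ℝ) (m : ℤ × ℤ) :
    edgeCoord D (q - p) p x m + edgeCoord D (r - q) q x m + edgeCoord D (p - r) r x m = 1 := by
  have hD' : (D : ℝ) ≠ 0 := by exact_mod_cast hD
  simp only [edgeCoord]
  rw [← add_div, ← add_div, div_eq_one_iff_eq hD', hDdef]
  simp only [zcross, rcross, Prod.fst_sub, Prod.snd_sub]
  push_cast
  ring

lemma mem_triangle_iff {p q r : ℤ × ℤ} {D : ℤ} (hD : D ≠ 0)
    (hDdef : D = zcross (q - p) (r - q)) (x : ℝ × ℝ) (m : ℤ × ℤ) :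
    toR2 m - x ∈ convexHull ℝ {toR2 p, toR2 q, toR2 r} ↔
      0 ≤ edgeCoord D (q - p) p x m ∧ 0 ≤ edgeCoord D (r - q) q x m ∧
        0 ≤ edgeCoord D (p - r) r x m := by
  have hD' : (D : ℝ) ≠ 0 := by exact_mod_cast hD
  have hDR : (D : ℝ) = (q.1 - p.1) * (r.2 - q.2) - (q.2 - p.2) * (r.1 - q.1) := by
    rw [hDdef]; simp [zcross]
  have hcoord (v p : ℤ × ℤ) :
      edgeCoord D v p x m = (rcross v (toR2 m - x) - rcross v (toR2 p)) / D := by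
    rw [sub_eq_add_neg (toR2 m), rcross_add, rcross_neg, rcross_toR2, rcross_toR2, edgeCoord,
      sub_eq_add_neg m, zcross_add]
    simp [zcross]
    ring
  simp only [hcoord]
  generalize toR2 m - x = y
  constructor
  · have hconv (v p : ℤ × ℤ) : Convex ℝ {y | 0 ≤ (rcross v y - rcross v (toR2 p)) / D} := by
      intro y hy z hz s t hs ht hst
      simp only [Set.mem_ofPred_eq] at hy hz ⊢
      have : (rcross v (s • y + t • z) - rcross v (toR2 p)) / D =
          s * ((rcross v y - rcross v (toR2 p)) / D) +
            t * ((rcross v z - rcross v (toR2 p)) / D) := by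
        have hlin : rcross v (s • y + t • z) = s * rcross v y + t * rcross v z := by
          simp [rcross]; ring
        rw [hlin]
        field_simp
        linear_combination rcross v (toR2 p) * hst
      rw [this]
      positivity
    intro hy
    refine convexHull_min ?_
      ((hconv (q - p) p).inter ((hconv (r - q) q).inter (hconv (p - r) r))) hy
    have h0 {t : ℝ} (ht : t = 0) : 0 ≤ t / D := by simp [ht]
    have h1 {t : ℝ} (ht : t = D) : 0 ≤ t / D := by simp [ht, hD']
    rintro _ (rfl | rfl | rfl) <;>
    simp only [Set.mem_inter_iff, Set.mem_ofPred_eq] <;>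
    refine ⟨?_, ?_, ?_⟩ <;>
    [apply h0; apply h1; apply h0; apply h0; apply h0; apply h1; apply h1; apply h0; apply h0] <;>
    · simp only [rcross, hDR, toR2, Prod.fst_sub, Prod.snd_sub]
      push_cast
      ring
  · rintro ⟨h1, h2, h3⟩
    have hsub := subset_convexHull ℝ {toR2 p, toR2 q, toR2 r}
    have hw : (rcross (q - p) y - rcross (q - p) (toR2 p)) / D +
        (rcross (r - q) y - rcross (r - q) (toR2 q)) / D +
        (rcross (p - r) y - rcross (p - r) (toR2 r)) / D = 1 := by
      rw [← add_div, ← add_div, div_eq_one_iff_eq hD', hDR]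
      simp only [rcross, toR2, Prod.fst_sub, Prod.snd_sub]
      push_cast
      ring
    have hy := (convex_convexHull ℝ {toR2 p, toR2 q, toR2 r}).sum_mem (t := Finset.univ)
      (w := ![(rcross (q - p) y - rcross (q - p) (toR2 p)) / D,
        (rcross (r - q) y - rcross (r - q) (toR2 q)) / D,
        (rcross (p - r) y - rcross (p - r) (toR2 r)) / D]) (z := ![toR2 r, toR2 p, toR2 q])
      (by simp [Fin.forall_fin_succ, h1, h2, h3]) (by simpa [Fin.sum_univ_three] using hw)
      (fun i _ => hsub (by fin_cases i <;> simp))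
    convert hy
    simp only [Fin.sum_univ_three, Matrix.cons_val]
    ext <;>
    · simp only [rcross, toR2, Prod.fst_sub, Prod.snd_sub, Prod.fst_add, Prod.snd_add,
        Prod.smul_fst, Prod.smul_snd, smul_eq_mul]
      push_cast
      field_simp
      rw [hDR]
      ring

lemma latCount_triangle {p q r : ℤ × ℤ} {D : ℤ} (hD : D ≠ 0)
    (hDdef : D = zcross (q - p) (r - q)) [Fintype ((ℤ × ℤ) ⧸ pairLattice (q - p) (r - q))]
    {x : ℝ × ℝ} (hx : ∀ n : ℤ, rcross (q - p) x ≠ n ∧ rcross (r - q) x ≠ n ∧ rcross (p - r) x ≠ n) :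
    (latCount (convexHull ℝ {toR2 p, toR2 q, toR2 r}) x : ℝ) =
      ∑ g : (ℤ × ℤ) ⧸ pairLattice (q - p) (r - q), (2 - (Int.fract (edgeCoord D (q - p) p x g.out) +
        Int.fract (edgeCoord D (r - q) q x g.out) + Int.fract (edgeCoord D (p - r) r x g.out))) := by
  set M := pairLattice (q - p) (r - q)
  set t₁ := edgeCoord D (q - p) p x
  set t₂ := edgeCoord D (r - q) q x
  set t₃ := edgeCoord D (p - r) r x
  have hsum (m) : t₁ m + t₂ m + t₃ m = 1 := edgeCoord_sum hD hDdef x m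
  have hshift (m : ℤ × ℤ) (k l : ℤ) :
      t₁ (m + (k • (q - p) + l • (r - q))) = t₁ m + l ∧
      t₂ (m + (k • (q - p) + l • (r - q))) = t₂ m + (-k : ℤ) ∧
      t₃ (m + (k • (q - p) + l • (r - q))) = t₃ m + (k - l : ℤ) := by
    refine ⟨edgeCoord_add hD ?_ _ _ _, edgeCoord_add hD ?_ _ _ _, edgeCoord_add hD ?_ _ _ _⟩ <;>
    · rw [hDdef]
      simp [zcross]
      ring
  have hne (m : ℤ × ℤ) (n : ℤ) : t₁ m ≠ n ∧ t₂ m ≠ n ∧ t₃ m ≠ n :=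
    ⟨edgeCoord_ne_intCast hD (fun n => (hx n).1) _ _ _,
      edgeCoord_ne_intCast hD (fun n => (hx n).2.1) _ _ _,
      edgeCoord_ne_intCast hD (fun n => (hx n).2.2) _ _ _⟩
  set A : Set (ℤ × ℤ) := {m | 0 ≤ t₁ m ∧ 0 ≤ t₂ m ∧ 0 ≤ t₃ m} with hA
  have hcount : latCount (convexHull ℝ {toR2 p, toR2 q, toR2 r}) x = A.ncard := by
    rw [latCount]
    congr 1
    ext m
    exact mem_triangle_iff hD hDdef x m
  have hfloor {m} (hm : m ∈ A) : ⌊t₁ m⌋ = 0 ∧ ⌊t₂ m⌋ = 0 ∧ ⌊t₃ m⌋ = 0 := by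
    obtain ⟨h1, h2, h3⟩ := hm
    have hs := hsum m
    obtain ⟨n1, n2, n3⟩ := hne m 0
    rw [Int.cast_zero] at n1 n2 n3
    have h1' := lt_of_le_of_ne h1 n1.symm
    have h2' := lt_of_le_of_ne h2 n2.symm
    have h3' := lt_of_le_of_ne h3 n3.symm
    simp only [Int.floor_eq_zero_iff, Set.mem_Ico]
    refine ⟨⟨h1, ?_⟩, ⟨h2, ?_⟩, ⟨h3, ?_⟩⟩ <;> linarith
  have hrel {m m' : ℤ × ℤ} (h : Submodule.Quotient.mk (p := M) m = Submodule.Quotient.mk m') :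
      ∃ k l : ℤ, m' = m + (k • (q - p) + l • (r - q)) := by
    obtain ⟨k, l, hkl⟩ := mem_pairLattice.1 ((Submodule.Quotient.eq M).1 h.symm)
    exact ⟨k, l, by rw [hkl, add_sub_cancel]⟩
  have hout (g : (ℤ × ℤ) ⧸ M) : Submodule.Quotient.mk (p := M) g.out = g := Quotient.out_eq g
  have hinj : Set.InjOn (Submodule.Quotient.mk (p := M)) A := by
    intro m hm m' hm' h
    obtain ⟨k, l, rfl⟩ := hrel h
    obtain ⟨s1, s2, -⟩ := hshift m k l
    obtain ⟨f1, f2, -⟩ := hfloor hm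
    obtain ⟨f1', f2', -⟩ := hfloor hm'
    rw [s1, Int.floor_add_intCast, f1, zero_add] at f1'
    rw [s2, Int.floor_add_intCast, f2, zero_add, neg_eq_zero] at f2'
    simp [f1', f2']
  have himage : Submodule.Quotient.mk (p := M) '' A =
      (Finset.univ.filter fun g : (ℤ × ℤ) ⧸ M =>
        ⌊t₁ g.out⌋ + ⌊t₂ g.out⌋ + ⌊t₃ g.out⌋ = 0 : Finset _) := by
    ext g
    simp only [Set.mem_image, Finset.coe_filter, Finset.mem_univ, true_and, Set.mem_ofPred_eq]
    constructor
    · rintro ⟨m, hm, rfl⟩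
      obtain ⟨k, l, hkl⟩ := hrel (hout (Submodule.Quotient.mk m)).symm
      obtain ⟨s1, s2, s3⟩ := hshift m k l
      obtain ⟨f1, f2, f3⟩ := hfloor hm
      rw [hkl, s1, s2, s3]
      simp only [Int.floor_add_intCast, f1, f2, f3]
      ring
    · intro h
      obtain ⟨s1, s2, s3⟩ := hshift g.out ⌊t₂ g.out⌋ (-⌊t₁ g.out⌋)
      refine ⟨g.out + (⌊t₂ g.out⌋ • (q - p) + (-⌊t₁ g.out⌋) • (r - q)), ?_, ?_⟩
      · simp only [hA, Set.mem_ofPred_eq]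
        rw [s1, s2, s3, show ⌊t₂ g.out⌋ - -⌊t₁ g.out⌋ = -⌊t₃ g.out⌋ by linarith]
        push_cast
        simp only [← sub_eq_add_neg, Int.self_sub_floor]
        exact ⟨Int.fract_nonneg _, Int.fract_nonneg _, Int.fract_nonneg _⟩
      · conv_rhs => rw [← hout g]
        rw [eq_comm, Submodule.Quotient.eq, sub_add_cancel_left, neg_mem_iff, mem_pairLattice]
        exact ⟨_, _, rfl⟩
  rw [hcount, ← hinj.ncard_image, himage, Set.ncard_coe_finset, Finset.card_filter]
  push_cast
  refine Finset.sum_congr (by congr!) fun g _ => ?_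
  have hfr : (2 - (Int.fract (t₁ g.out) + Int.fract (t₂ g.out) + Int.fract (t₃ g.out)) : ℝ) =
      ((1 + (⌊t₁ g.out⌋ + ⌊t₂ g.out⌋ + ⌊t₃ g.out⌋) : ℤ) : ℝ) := by
    have := hsum g.out
    simp only [← Int.self_sub_floor]
    push_cast
    linarith
  rw [hfr]
  have h0 : (t₁ g.out - 1) + t₂ g.out + t₃ g.out = 0 := by linarith [hsum g.out]
  have h' := floor_add_floor_add_floor h0 fun n hn => (hne g.out (n + 1)).1 (by push_cast; linarith)
  rw [Int.floor_sub_one] at h'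
  split_ifs with h
  · rw [h]; simp
  · rw [show 1 + (⌊t₁ g.out⌋ + ⌊t₂ g.out⌋ + ⌊t₃ g.out⌋) = 0 by omega]; simp

lemma natCast_mul_fract_div {a : ℕ} (ha : 0 < a) (R : ℝ) :
    a * Int.fract (R / a) = R + ((⌊R⌋ % a - ⌊R⌋ : ℤ) : ℝ) := by
  have ha' : (a : ℝ) ≠ 0 := by exact_mod_cast ha.ne'
  rw [← Int.self_sub_floor, Int.floor_div_natCast, Int.emod_def]
  push_cast
  field_simp
  ring

lemma exists_latCount_eq_add_floorStat {p q r : ℤ × ℤ} {D : ℤ} (hD : D ≠ 0)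
    (hDdef : D = zcross (q - p) (r - q)) {a b c : ℕ}
    (ha : a = Int.gcd (q - p).1 (q - p).2)
    (hb : b = Int.gcd (r - q).1 (r - q).2)
    (hc : c = Int.gcd (p - r).1 (p - r).2) (ha0 : 0 < a) (hb0 : 0 < b) (hc0 : 0 < c) :
    ∃ κ : ℝ, ∀ x, (∀ n : ℤ, rcross (q - p) x ≠ n ∧ rcross (r - q) x ≠ n ∧ rcross (p - r) x ≠ n) →
      (latCount (convexHull ℝ {toR2 p, toR2 q, toR2 r}) x : ℝ) = κ +
        floorStat (D.sign • (q - p)) (D.sign • (r - q)) (D.sign • (p - r)) a b c x := by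
  have hcard := card_quotient_pairLattice (hDdef ▸ hD)
  have : Finite ((ℤ × ℤ) ⧸ pairLattice (q - p) (r - q)) := by
    refine Nat.finite_of_card_ne_zero ?_
    rw [hcard, ← hDdef]
    exact Int.natAbs_ne_zero.2 hD
  let _ := Fintype.ofFinite ((ℤ × ℤ) ⧸ pairLattice (q - p) (r - q))
  rw [← hDdef, Nat.card_eq_fintype_card] at hcard
  have hD2 : D = zcross (r - q) (p - r) := by rw [hDdef]; simp [zcross]; ring
  have hD3 : D = zcross (p - r) (q - p) := by rw [hDdef]; simp [zcross]; ring
  have hmem (v : ℤ × ℤ) (h1 : D ∣ zcross v (q - p)) (h2 : D ∣ zcross v (r - q)) :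
      ∀ k ∈ pairLattice (q - p) (r - q), D ∣ zcross v k := by
    intro k hk
    obtain ⟨i, j, rfl⟩ := mem_pairLattice.1 hk
    rw [zcross_add, zcross_smul, zcross_smul]
    exact dvd_add (h1.mul_left _) (h2.mul_left _)
  have hself (v : ℤ × ℤ) : D ∣ zcross v v := by
    rw [show zcross v v = 0 by simp [zcross, mul_comm]]; exact dvd_zero _
  have hswap (v w : ℤ × ℤ) (h : D = zcross w v) : D ∣ zcross v w := by
    rw [show zcross v w = -zcross w v by simp [zcross]; ring, h]; exact (dvd_refl _).neg_right
  obtain ⟨κ₁, h₁⟩ := sum_fract_zcross hD hcard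
    (hmem (q - p) (hself _) hDdef.dvd) ha (by rw [hDdef, ha]; exact gcd_dvd_zcross _ _) p
  obtain ⟨κ₂, h₂⟩ := sum_fract_zcross hD hcard
    (hmem (r - q) (hswap _ _ hDdef) (hself _)) hb (by rw [hD2, hb]; exact gcd_dvd_zcross _ _) q
  obtain ⟨κ₃, h₃⟩ := sum_fract_zcross hD hcard
    (hmem (p - r) hD3.dvd (hswap _ _ hD2)) hc (by rw [hD3, hc]; exact gcd_dvd_zcross _ _) r
  refine ⟨2 * D.natAbs - (a + b + c) - (κ₁ + κ₂ + κ₃) + 1, fun x hx => ?_⟩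
  have hsm (v : ℤ × ℤ) : rcross (D.sign • v) x = D.sign * rcross v x := by
    simp [rcross]; ring
  have hfract {n : ℕ} (hn : 0 < n) {v : ℤ × ℤ} (hv : ∀ n : ℤ, rcross v x ≠ n) :
      n * Int.fract (-(D.sign * rcross v x / n)) = n - (D.sign * rcross v x +
        ((⌊rcross (D.sign • v) x⌋ % n - ⌊rcross (D.sign • v) x⌋ : ℤ) : ℝ)) := by
    have hn' : (n : ℝ) ≠ 0 := by exact_mod_cast hn.ne'
    have hsign : (D.sign : ℝ) * D.sign = 1 := by
      obtain h | h := hD.lt_or_gt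
      · simp [Int.sign_eq_neg_one_of_neg h]
      · simp [Int.sign_eq_one_of_pos h]
    have hne : Int.fract (D.sign * rcross v x / n) ≠ 0 := by
      intro h
      obtain ⟨t, ht⟩ := Int.fract_eq_zero_iff.1 h
      rw [eq_div_iff hn'] at ht
      apply hv (D.sign * (t * n))
      push_cast
      rw [ht]
      linear_combination (-rcross v x) * hsign
    rw [Int.fract_neg hne, mul_sub, mul_one, natCast_mul_fract_div hn, hsm]
  rw [latCount_triangle hD hDdef hx, Finset.sum_sub_distrib, Finset.sum_add_distrib,
    Finset.sum_add_distrib]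
  simp only [edgeCoord]
  rw [h₁, h₂, h₃, hfract ha0 fun n => (hx n).1, hfract hb0 fun n => (hx n).2.1,
    hfract hc0 fun n => (hx n).2.2, Finset.sum_const, Finset.card_univ, hcard,
    rcross_eq_neg_sub (w₁ := q - p) (w₂ := r - q) (w₃ := p - r) (by abel), floorStat, nsmul_eq_mul]
  push_cast
  ring

/-- Let `T` be an integer triangle whose sides have affine lengths
`a, b, c` with `gcd(a,b,c) = 1`. Then `X_T - E[X_T]` is distributed as
`U_a + U_b + U_c + U_2 - E[U_a + U_b + U_c + U_2]` with independent uniform summands. -/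
theorem latCount_triangle_distribution (p q r : ℤ × ℤ)
    (hT : zcross (q - p) (r - p) ≠ 0)
    (T : Set (ℝ × ℝ)) (hTdef : T = convexHull ℝ {toR2 p, toR2 q, toR2 r})
    (a b c : ℕ)
    (ha : a = Int.gcd (q - p).1 (q - p).2)
    (hb : b = Int.gcd (r - q).1 (r - q).2)
    (hc : c = Int.gcd (p - r).1 (p - r).2)
    (hgcd : Nat.gcd a (Nat.gcd b c) = 1) :
    Measure.map (fun x => (latCount T x : ℝ) - ∫ y, (latCount T y : ℝ) ∂μunit) μunit
      = Measure.map (fun s => s - ∫ z, z ∂lawS a b c) (lawS a b c) := by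
  subst hTdef
  have hD : zcross (q - p) (r - q) ≠ 0 := by
    convert hT using 1
    simp [zcross]
    ring
  have hv : q - p + (r - q) + (p - r) = 0 := by abel
  have hpos {v : ℤ × ℤ} {n : ℕ} (hn : n = Int.gcd v.1 v.2) (h : v ≠ 0) : 0 < n := by
    rw [hn, Int.gcd_pos_iff]
    contrapose! h
    exact Prod.ext h.1 h.2
  have h12 := ne_zero_of_zcross_ne_zero hD
  have ha0 := hpos ha h12.1
  have hb0 := hpos hb h12.2
  have hc0 := hpos hc (ne_zero_of_zcross_ne_zero ((zcross_right_eq hv).trans_ne hD)).2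
  obtain ⟨κ, hκ⟩ := exists_latCount_eq_add_floorStat hD rfl ha hb hc ha0 hb0 hc0
  set ε := (zcross (q - p) (r - q)).sign
  have hdvd {v : ℤ × ℤ} {n : ℕ} (hn : n = Int.gcd v.1 v.2) : ∃ ξ, ε • v = n • ξ := by
    obtain ⟨i, hi⟩ := Int.gcd_dvd_left v.1 v.2
    obtain ⟨j, hj⟩ := Int.gcd_dvd_right v.1 v.2
    refine ⟨(ε * i, ε * j), ?_⟩
    rw [← hn] at hi hj
    rw [Prod.smul_mk, Prod.smul_def, hi, hj]
    simp [mul_left_comm]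
  have hε0 : ε ≠ 0 := Int.sign_eq_zero_iff_zero.not.2 hD
  have hlaw := map_floorStat ha0 hb0 hc0 (w₁ := ε • (q - p)) (w₂ := ε • (r - q))
    (w₃ := ε • (p - r)) (by rw [← smul_add, ← smul_add, hv, smul_zero])
    (by
      rw [show zcross (ε • (q - p)) (ε • (r - q)) = ε * ε * zcross (q - p) (r - q) by
        simp [zcross]; ring]
      exact mul_ne_zero (mul_ne_zero hε0 hε0) hD)
    (hdvd ha) (hdvd hb) (hdvd hc) hgcd
  have hmeas := measurable_floorStat (ε • (q - p)) (ε • (r - q)) (ε • (p - r)) a b c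
  set N : ℝ × ℝ → ℝ :=
    fun x => (floorStat (ε • (q - p)) (ε • (r - q)) (ε • (p - r)) a b c x : ℝ)
  have hint : Integrable N μunit := by
    have h : Integrable id (μunit.map N) := by
      rw [hlaw, lawS]
      refine Integrable.smul_measure (integrable_finsetSum_measure.2 fun k _ => ?_) ?_
      · exact integrable_dirac (by simp)
      · simp [ENNReal.inv_eq_top, ha0.ne', hb0.ne', hc0.ne']
    exact (integrable_map_measure aestronglyMeasurable_id hmeas.aemeasurable).1 h
  have hae : (fun x => (latCount (convexHull ℝ {toR2 p, toR2 q, toR2 r}) x : ℝ)) =ᵐ[μunit]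
      fun x => κ + N x := by
    filter_upwards [ae_forall_rcross_ne hv hD] with x hx using hκ x hx
  have hmean : ∫ y, (latCount (convexHull ℝ {toR2 p, toR2 q, toR2 r}) y : ℝ) ∂μunit =
      κ + ∫ z, z ∂lawS a b c := by
    rw [integral_congr_ae hae, integral_add (integrable_const _) hint, ← hlaw,
      integral_map (f := fun z => z) hmeas.aemeasurable aestronglyMeasurable_id]
    simp
  have hcongr : (fun x => (latCount (convexHull ℝ {toR2 p, toR2 q, toR2 r}) x : ℝ) -
      (κ + ∫ z, z ∂lawS a b c)) =ᵐ[μunit] (fun s => s - ∫ z, z ∂lawS a b c) ∘ N := by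
    filter_upwards [hae] with x hx
    rw [hx, Function.comp_apply]
    ring
  rw [hmean, Measure.map_congr hcongr, ← Measure.map_map (by fun_prop) hmeas, hlaw]
end
end

section
/- Let T ⊂ ℝ² be a triangle with vertices in ℤ² whose sides, in counterclockwise order, are a·v₁, b·v₂, c·v₃ with v₁, v₂, v₃ primitive integer vectors and a, b, c the affine lengths of the sides. Then X_T equals a + b + c − a·{X ∧ v₁} − b·{X ∧ v₂} − c·{X ∧ v₃} up to an additive constant, where {·} denotes the fractional part, x ∧ v = x₁v₂ − x₂v₁, and X is uniform on [0,1]². -/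
open MeasureTheory

noncomputable section

/-- The wedge product `x ∧ y = x₁y₂ - x₂y₁` of two vectors of `ℝ²`. -/
def wedge (x y : ℝ × ℝ) : ℝ := x.1 * y.2 - x.2 * y.1

theorem sum_Icc_ite_le {M h : ℤ} (h₁ : -M - 1 ≤ h) (h₂ : h ≤ M) :
    ∑ k ∈ Finset.Icc (-M) M, (if k ≤ h then (1 : ℤ) else 0) = h + M + 1 := by
  have hf : (Finset.Icc (-M) M).filter (· ≤ h) = Finset.Icc (-M) h := by
    ext k; simp only [Finset.mem_filter, Finset.mem_Icc]; omega
  rw [Finset.sum_boole, hf, Int.card_Icc]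
  omega

theorem add_one_ediv_eq (z : ℤ) {w : ℤ} (hw : 0 < w) :
    (z + 1) / w = z / w + if w ∣ z + 1 then 1 else 0 := by
  split_ifs with h
  · obtain ⟨k, hk⟩ := h
    rw [hk, Int.mul_ediv_cancel_left _ hw.ne', show z = (w - 1) + w * (k - 1) by linarith,
      Int.add_mul_ediv_left _ _ hw.ne', Int.ediv_eq_zero_of_lt (by omega) (by omega)]
    ring
  · have hne : (z + 1) % w ≠ 0 := fun h0 => h (Int.dvd_of_emod_eq_zero h0)
    have hlt := Int.emod_lt_of_pos (z + 1) hw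
    have hnn := Int.emod_nonneg (z + 1) hw.ne'
    rw [add_zero, eq_comm, Int.ediv_eq_iff_of_pos hw]
    have := Int.mul_ediv_add_emod (z + 1) w
    have hrem : 1 ≤ (z + 1) % w := by omega
    constructor <;> nlinarith

theorem card_Ioc_filter_dvd {u w A B : ℤ} {a : ℕ} (hw : 0 < w) (hg : IsCoprime u w)
    (hAB : B - A = a * w) (n : ℤ) :
    ((Finset.Ioc A B).filter (fun j => w ∣ u * j + n)).card = a := by
  obtain ⟨s, t, hst⟩ := hg
  have hf : (Finset.Ioc A B).filter (fun j => w ∣ u * j + n)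
      = (Finset.Ioc A B).filter (fun j => j ≡ -(s * n) [ZMOD w]) := by
    ext j
    simp only [Finset.mem_filter, and_congr_right_iff]
    intro _
    rw [Int.modEq_comm, Int.modEq_iff_dvd]
    constructor
    · rintro ⟨k, hk⟩
      exact ⟨t * j + s * k, by linear_combination s * hk - j * hst⟩
    · rintro ⟨k, hk⟩
      exact ⟨u * k + n * t, by linear_combination u * hk - n * hst⟩
  have hc := Int.Ioc_filter_modEq_card A B hw (-(s * n))
  rw [hf]
  have hB : ((B : ℚ) - (-(s * n) : ℤ)) / w = ((A : ℚ) - (-(s * n) : ℤ)) / w + (a : ℤ) := by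
    have hw' : (w : ℚ) ≠ 0 := by exact_mod_cast hw.ne'
    have : (B : ℚ) = A + a * w := by exact_mod_cast (by linarith : B = A + a * w)
    rw [this]; field_simp; push_cast; ring
  rw [hB, Int.floor_add_intCast] at hc
  have h0 : (0 : ℤ) ≤ a := Int.natCast_nonneg a
  rw [add_sub_cancel_left, max_eq_left h0] at hc
  exact_mod_cast hc

/-- A Hermite-type identity: summing `⌊(u j + n) / w⌋` over `a` complete residue systems
gives a function of `n` that is affine with slope `a`. -/
theorem exists_sum_ediv_eq {u w A B : ℤ} {a : ℕ} (hw : 0 < w) (hg : IsCoprime u w)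
    (hAB : B - A = a * w) :
    ∃ K : ℤ, ∀ n : ℤ, ∑ j ∈ Finset.Ioc A B, (u * j + n) / w = a * n + K := by
  have step (n : ℤ) : ∑ j ∈ Finset.Ioc A B, (u * j + (n + 1)) / w
      = ∑ j ∈ Finset.Ioc A B, (u * j + n) / w + a := by
    simp_rw [← add_assoc, add_one_ediv_eq _ hw, Finset.sum_add_distrib, add_assoc,
      Finset.sum_boole, card_Ioc_filter_dvd hw hg hAB]
  refine ⟨∑ j ∈ Finset.Ioc A B, (u * j + 0) / w, fun n => ?_⟩
  induction n using Int.induction_on with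
  | zero => simp
  | succ k ih => rw [step, ih]; ring
  | pred k ih =>
    have := step (-k - 1)
    rw [sub_add_cancel, ih] at this
    linarith

/-- The number of lattice points of a large box which lie below a line of slope `u / w`, in the
columns of a half-open interval. -/
theorem exists_sum_box_below {u w A B : ℤ} {a : ℕ} (hw : 0 < w) (hg : IsCoprime u w)
    (hAB : B - A = a * w) :
    ∃ K : ℤ, ∀ n : ℤ, ∀ᶠ M : ℤ in Filter.atTop,
      ∑ m ∈ Finset.Icc (-M) M ×ˢ Finset.Icc (-M) M,
        (if A < m.1 ∧ m.1 ≤ B ∧ w * m.2 ≤ u * m.1 + n then (1 : ℤ) else 0)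
        = a * n + K + (B - A) * (M + 1) := by
  obtain ⟨K, hK⟩ := exists_sum_ediv_eq hw hg hAB
  refine ⟨K, fun n => ?_⟩
  have hbd : ∀ᶠ M : ℤ in Filter.atTop, ∀ j ∈ Finset.Ioc A B, |(u * j + n) / w| ≤ M :=
    (Filter.eventually_all_finset _).2 fun j _ => Filter.eventually_ge_atTop _
  filter_upwards [hbd, Filter.eventually_ge_atTop |A|, Filter.eventually_ge_atTop |B|]
    with M hM hA hB
  rw [abs_le] at hA hB
  have hsub : (Finset.Icc (-M) M).filter (fun j => A < j ∧ j ≤ B) = Finset.Ioc A B := by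
    ext j; simp only [Finset.mem_filter, Finset.mem_Icc, Finset.mem_Ioc]; omega
  have hcol (j : ℤ) : ∑ k ∈ Finset.Icc (-M) M,
      (if A < j ∧ j ≤ B ∧ w * k ≤ u * j + n then (1 : ℤ) else 0)
      = if A < j ∧ j ≤ B then (u * j + n) / w + (M + 1) else 0 := by
    split_ifs with hj
    · have := abs_le.1 (hM j (Finset.mem_Ioc.2 hj))
      rw [← add_assoc, ← sum_Icc_ite_le (by linarith) this.2]
      refine Finset.sum_congr rfl fun k _ => ?_
      simp only [hj.1, hj.2, true_and, Int.le_ediv_iff_mul_le hw, mul_comm k]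
    · refine Finset.sum_eq_zero fun k _ => if_neg fun h => hj ⟨h.1, h.2.1⟩
  have hBA : 0 ≤ B - A := hAB ▸ by positivity
  rw [Finset.sum_product]
  simp_rw [hcol]
  rw [← Finset.sum_filter, hsub, Finset.sum_add_distrib, hK, Finset.sum_const, Int.card_Ioc,
    nsmul_eq_mul, Int.toNat_of_nonneg hBA]

open Classical in
/-- The signed indicator of the region below the oriented segment from `p` to `q`: it is `1` there
if the segment runs to the left and `-1` if it runs to the right. -/
def belowSign (p q y : ℝ × ℝ) : ℤ :=
  if q.1 < y.1 ∧ y.1 < p.1 ∧ 0 < wedge (q - p) (y - p) then 1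
  else if p.1 < y.1 ∧ y.1 < q.1 ∧ wedge (q - p) (y - p) < 0 then -1 else 0

open Classical in
theorem belowSign_add_add {p q r y : ℝ × ℝ} (hccw : 0 < wedge (q - p) (r - p))
    (hp : y.1 ≠ p.1) (hq : y.1 ≠ q.1) (hr : y.1 ≠ r.1)
    (h₁ : wedge (q - p) (y - p) ≠ 0) (h₂ : wedge (r - q) (y - q) ≠ 0)
    (h₃ : wedge (p - r) (y - r) ≠ 0) :
    belowSign p q y + belowSign q r y + belowSign r p y
      = if 0 < wedge (q - p) (y - p) ∧ 0 < wedge (r - q) (y - q) ∧ 0 < wedge (p - r) (y - r)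
        then 1 else 0 := by
  have hsum : wedge (q - p) (y - p) + wedge (r - q) (y - q) + wedge (p - r) (y - r)
      = wedge (q - p) (r - p) := by
    simp only [wedge, Prod.fst_sub, Prod.snd_sub]; ring
  have hbar : wedge (r - q) (y - q) * (p.1 - y.1) + wedge (p - r) (y - r) * (q.1 - y.1)
      + wedge (q - p) (y - p) * (r.1 - y.1) = 0 := by
    simp only [wedge, Prod.fst_sub, Prod.snd_sub]; ring
  rw [← hsum] at hccw
  clear hsum
  unfold belowSign
  generalize wedge (q - p) (y - p) = α at *
  generalize wedge (r - q) (y - q) = β at *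
  generalize wedge (p - r) (y - r) = γ at *
  rcases lt_or_gt_of_ne hp with hp | hp <;> rcases lt_or_gt_of_ne hq with hq | hq <;>
  rcases lt_or_gt_of_ne hr with hr | hr <;> rcases lt_or_gt_of_ne h₁ with h₁ | h₁ <;>
  rcases lt_or_gt_of_ne h₂ with h₂ | h₂ <;> rcases lt_or_gt_of_ne h₃ with h₃ | h₃ <;>
  simp only [hp, hq, hr, h₁, h₂, h₃, hp.not_gt, hq.not_gt, hr.not_gt, h₁.not_gt, h₂.not_gt,
    h₃.not_gt, and_true, and_false, if_true, if_false] <;>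
  norm_num <;>
  nlinarith

theorem mem_convexHull_triangle_iff {p q r : ℝ × ℝ} (hccw : 0 < wedge (q - p) (r - p))
    (y : ℝ × ℝ) :
    y ∈ convexHull ℝ {p, q, r} ↔
      0 ≤ wedge (q - p) (y - p) ∧ 0 ≤ wedge (r - q) (y - q) ∧ 0 ≤ wedge (p - r) (y - r) := by
  constructor
  · have hconv (s t : ℝ × ℝ) : Convex ℝ {y | 0 ≤ wedge (t - s) (y - s)} := by
      intro y hy z hz α β hα hβ hαβ
      simp only [Set.mem_ofPred_eq] at *
      have : wedge (t - s) (α • y + β • z - s)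
          = α * wedge (t - s) (y - s) + β * wedge (t - s) (z - s) := by
        simp only [wedge, Prod.fst_sub, Prod.snd_sub, Prod.fst_add, Prod.snd_add, Prod.smul_fst,
          Prod.smul_snd, smul_eq_mul]
        linear_combination ((t.1 - s.1) * s.2 - (t.2 - s.2) * s.1) * hαβ
      rw [this]
      positivity
    refine fun hy => convexHull_min ?_ ((hconv p q).inter ((hconv q r).inter (hconv r p))) hy
    simp only [wedge, Prod.fst_sub, Prod.snd_sub] at hccw
    rintro z (rfl | rfl | rfl) <;>
    simp only [wedge, Prod.fst_sub, Prod.snd_sub, Set.mem_inter_iff, Set.mem_ofPred_eq] <;>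
    refine ⟨?_, ?_, ?_⟩ <;> linarith
  · rintro ⟨h₁, h₂, h₃⟩
    set D := wedge (q - p) (r - p) with hD
    have hsum : wedge (q - p) (y - p) + wedge (r - q) (y - q) + wedge (p - r) (y - r) = D := by
      simp only [hD, wedge, Prod.fst_sub, Prod.snd_sub]; ring
    have key := (convex_convexHull ℝ ({p, q, r} : Set (ℝ × ℝ))).sum_mem (t := Finset.univ)
      (w := ![wedge (r - q) (y - q) / D, wedge (p - r) (y - r) / D, wedge (q - p) (y - p) / D])
      (z := ![p, q, r])
      (by intro i _; fin_cases i <;> simp <;> positivity)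
      (by simp [Fin.sum_univ_three]; field_simp; linarith)
      (by intro i _; apply subset_convexHull; fin_cases i <;> simp)
    convert key
    simp only [Fin.sum_univ_three, Matrix.cons_val]
    ext <;> simp only [Prod.fst_add, Prod.snd_add, Prod.smul_fst, Prod.smul_snd, smul_eq_mul] <;>
    field_simp <;> simp only [hD, wedge, Prod.fst_sub, Prod.snd_sub] <;> ring

theorem ae_wedge_ne_intCast {v : ℤ × ℤ} (hv : v ≠ 0) :
    ∀ᵐ x : ℝ × ℝ, ∀ k : ℤ, wedge x (toR2 v) ≠ k := by
  rw [ae_all_iff]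
  intro k
  let L : ℝ × ℝ →ₗ[ℝ] ℝ :=
    (v.2 : ℝ) • LinearMap.fst ℝ ℝ ℝ - (v.1 : ℝ) • LinearMap.snd ℝ ℝ ℝ
  have hL (x : ℝ × ℝ) : wedge x (toR2 v) = L x := by
    simp [L, wedge, toR2]; ring
  have hker : LinearMap.ker L ≠ ⊤ := by
    intro h
    rw [LinearMap.ker_eq_top] at h
    have e₁ := LinearMap.congr_fun h (1, 0)
    have e₂ := LinearMap.congr_fun h (0, 1)
    simp [L] at e₁ e₂
    exact hv (Prod.ext e₂ e₁)
  rw [ae_iff]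
  simp only [not_not, hL]
  by_cases hx : ∃ x₀, L x₀ = k
  · obtain ⟨x₀, hx₀⟩ := hx
    have : {x | L x = k} = (fun x => x + -x₀) ⁻¹' (LinearMap.ker L : Set (ℝ × ℝ)) := by
      ext x
      simp [hx₀, ← sub_eq_add_neg, sub_eq_zero]
    rw [this, measure_preimage_add_right]
    exact Measure.addHaar_submodule _ _ hker
  · push Not at hx
    simp [hx]

theorem wedge_toR2_sub {p q v : ℤ × ℤ} {a : ℕ} (h : q - p = (a : ℤ) • v)
    (x : ℝ × ℝ) (m : ℤ × ℤ) :
    wedge (toR2 q - toR2 p) (toR2 m - x - toR2 p)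
      = a * (wedge x (toR2 v) - ((v.2 * (m.1 - p.1) - v.1 * (m.2 - p.2) : ℤ) : ℝ)) := by
  have e₁ : (q.1 : ℝ) - p.1 = a * v.1 := by exact_mod_cast congrArg Prod.fst h
  have e₂ : (q.2 : ℝ) - p.2 = a * v.2 := by exact_mod_cast congrArg Prod.snd h
  simp only [wedge, toR2, Prod.fst_sub, Prod.snd_sub, e₁, e₂]
  push_cast
  ring

theorem intCast_lt_sub_iff {t : ℝ} (h₀ : 0 < t) (h₁ : t < 1) (s j : ℤ) :
    (s : ℝ) < j - t ↔ s < j := by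
  refine ⟨fun h => ?_, fun h => ?_⟩
  · have : (s : ℝ) < j := by linarith
    exact_mod_cast this
  · have : (s : ℝ) + 1 ≤ j := by exact_mod_cast h
    linarith

theorem sub_lt_intCast_iff {t : ℝ} (h₀ : 0 < t) (h₁ : t < 1) (s j : ℤ) :
    (j : ℝ) - t < s ↔ j ≤ s := by
  refine ⟨fun h => ?_, fun h => ?_⟩
  · have : (j : ℝ) < s + 1 := by linarith
    exact Int.lt_add_one_iff.1 (by exact_mod_cast this)
  · have : (j : ℝ) ≤ s := by exact_mod_cast h
    linarith

theorem exists_sum_belowSign {p q v : ℤ × ℤ} {a : ℕ} (ha : 0 < a)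
    (hprim : Int.gcd v.1 v.2 = 1) (h : q - p = (a : ℤ) • v) :
    ∃ K : ℤ, ∀ x : ℝ × ℝ, 0 < x.1 → x.1 < 1 → (∀ k : ℤ, wedge x (toR2 v) ≠ k) →
      ∀ᶠ M : ℤ in Filter.atTop,
        ∑ m ∈ Finset.Icc (-M) M ×ˢ Finset.Icc (-M) M, belowSign (toR2 p) (toR2 q) (toR2 m - x)
          = a * ⌊wedge x (toR2 v)⌋ + K + (p.1 - q.1) * (M + 1) := by
  have ha' : (0 : ℝ) < a := by exact_mod_cast ha
  have haz : (0 : ℤ) < a := by exact_mod_cast ha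
  have hq : q.1 - p.1 = a * v.1 := congrArg Prod.fst h
  have hcop : IsCoprime v.2 v.1 := by
    rw [Int.isCoprime_iff_gcd_eq_one, Int.gcd_comm]; exact hprim
  have hsign (x : ℝ × ℝ) (hx₀ : 0 < x.1) (hx₁ : x.1 < 1)
      (hx : ∀ k : ℤ, wedge x (toR2 v) ≠ k) (m : ℤ × ℤ) :
      belowSign (toR2 p) (toR2 q) (toR2 m - x) =
        if q.1 < m.1 ∧ m.1 ≤ p.1 ∧
          v.2 * (m.1 - p.1) - v.1 * (m.2 - p.2) ≤ ⌊wedge x (toR2 v)⌋ then 1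
        else if p.1 < m.1 ∧ m.1 ≤ q.1 ∧
          ⌊wedge x (toR2 v)⌋ < v.2 * (m.1 - p.1) - v.1 * (m.2 - p.2) then -1 else 0 := by
    have hpos (z : ℤ) : 0 < a * (wedge x (toR2 v) - z) ↔ z ≤ ⌊wedge x (toR2 v)⌋ := by
      rw [mul_pos_iff_of_pos_left ha', sub_pos, Int.le_floor]
      exact ⟨le_of_lt, fun h => lt_of_le_of_ne h (hx z).symm⟩
    have hneg (z : ℤ) : a * (wedge x (toR2 v) - z) < 0 ↔ ⌊wedge x (toR2 v)⌋ < z := by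
      rw [← neg_pos, ← mul_neg, mul_pos_iff_of_pos_left ha', neg_sub, sub_pos, Int.floor_lt]
    rw [belowSign, wedge_toR2_sub h]
    simp only [hpos, hneg]
    simp only [toR2, Prod.fst_sub, intCast_lt_sub_iff hx₀ hx₁, sub_lt_intCast_iff hx₀ hx₁]
    congr!
  rcases lt_trichotomy v.1 0 with hv | hv | hv
  · have hqp : q.1 < p.1 := by nlinarith
    obtain ⟨K, hK⟩ := exists_sum_box_below (u := -v.2) (w := -v.1) (A := q.1) (B := p.1) (a := a)
      (by omega) hcop.neg_neg (by linarith)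
    refine ⟨K + a * (v.2 * p.1 - v.1 * p.2), fun x hx₀ hx₁ hx => ?_⟩
    filter_upwards [hK (⌊wedge x (toR2 v)⌋ + (v.2 * p.1 - v.1 * p.2))] with M hM
    rw [show ∀ f K' s : ℤ, a * f + (K + a * K') + s = a * (f + K') + K + s by intros; ring, ← hM]
    refine Finset.sum_congr rfl fun m _ => ?_
    rw [hsign x hx₀ hx₁ hx]
    have hiff : v.2 * (m.1 - p.1) - v.1 * (m.2 - p.2) ≤ ⌊wedge x (toR2 v)⌋ ↔
        -v.1 * m.2 ≤ -v.2 * m.1 + (⌊wedge x (toR2 v)⌋ + (v.2 * p.1 - v.1 * p.2)) := by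
      constructor <;> intro <;> linarith
    have hno : ¬(p.1 < m.1 ∧ m.1 ≤ q.1 ∧
        ⌊wedge x (toR2 v)⌋ < v.2 * (m.1 - p.1) - v.1 * (m.2 - p.2)) := by omega
    rw [if_neg hno]
    simp only [hiff]
  · have hqp : q.1 = p.1 := by rw [hv] at hq; linarith
    have hunit : IsUnit v.2 := by rwa [hv, isCoprime_zero_right] at hcop
    refine ⟨if v.2 = 1 then 0 else a, fun x hx₀ hx₁ hx => Filter.Eventually.of_forall fun M => ?_⟩
    rw [Finset.sum_eq_zero]
    · rcases Int.isUnit_iff.1 hunit with hu | hu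
      · have : ⌊wedge x (toR2 v)⌋ = 0 := by
          rw [Int.floor_eq_iff]
          simp only [wedge, toR2, hv, hu]
          constructor <;> push_cast <;> linarith
        simp [this, hu, hqp]
      · have : ⌊wedge x (toR2 v)⌋ = -1 := by
          rw [Int.floor_eq_iff]
          simp only [wedge, toR2, hv, hu]
          constructor <;> push_cast <;> linarith
        simp [this, hu, hqp]
    · intro m _
      rw [hsign x hx₀ hx₁ hx, if_neg (by omega), if_neg (by omega)]
  · have hqp : p.1 < q.1 := by nlinarith
    obtain ⟨K, hK⟩ := exists_sum_box_below (u := v.2) (w := v.1) (A := p.1) (B := q.1) (a := a)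
      hv hcop (by linarith)
    refine ⟨-K - a * (v.1 * p.2 - v.2 * p.1 - 1), fun x hx₀ hx₁ hx => ?_⟩
    filter_upwards [hK (-⌊wedge x (toR2 v)⌋ + (v.1 * p.2 - v.2 * p.1 - 1))] with M hM
    rw [show ∀ f K' : ℤ, a * f + (-K - a * K') + (p.1 - q.1) * (M + 1)
      = -(a * (-f + K') + K + (q.1 - p.1) * (M + 1)) by intros; ring, ← hM,
      ← Finset.sum_neg_distrib]
    refine Finset.sum_congr rfl fun m _ => ?_
    rw [hsign x hx₀ hx₁ hx]
    have hiff : ⌊wedge x (toR2 v)⌋ < v.2 * (m.1 - p.1) - v.1 * (m.2 - p.2) ↔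
        v.1 * m.2 ≤ v.2 * m.1 + (-⌊wedge x (toR2 v)⌋ + (v.1 * p.2 - v.2 * p.1 - 1)) := by
      rw [Int.lt_iff_add_one_le]
      constructor <;> intro <;> linarith
    have hno : ¬(q.1 < m.1 ∧ m.1 ≤ p.1 ∧
        v.2 * (m.1 - p.1) - v.1 * (m.2 - p.2) ≤ ⌊wedge x (toR2 v)⌋) := by omega
    rw [if_neg hno, apply_ite Neg.neg, neg_zero]
    simp only [hiff]

theorem eventually_latCount_eq_sum_box {T : Set (ℝ × ℝ)} (hT : Bornology.IsBounded T) (x : ℝ × ℝ)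
    {f : ℤ × ℤ → ℤ} (hf : ∀ m, f m = Set.indicator {m | toR2 m - x ∈ T} 1 m) :
    ∀ᶠ M : ℤ in Filter.atTop,
      (latCount T x : ℤ) = ∑ m ∈ Finset.Icc (-M) M ×ˢ Finset.Icc (-M) M, f m := by
  classical
  obtain ⟨R, hR⟩ := hT.exists_norm_le
  filter_upwards [Filter.eventually_ge_atTop ⌈R + ‖x‖⌉] with M hM
  have hM' : R + ‖x‖ ≤ M := Int.ceil_le.1 hM
  have hset : {m : ℤ × ℤ | toR2 m - x ∈ T}
      = ((Finset.Icc (-M) M ×ˢ Finset.Icc (-M) M).filter (fun m => toR2 m - x ∈ T) :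
          Finset (ℤ × ℤ)) := by
    ext m
    simp only [Set.mem_ofPred_eq, Finset.coe_filter, Finset.mem_product, Finset.mem_Icc]
    refine ⟨fun hm => ⟨?_, hm⟩, fun hm => hm.2⟩
    have hn : ‖toR2 m‖ ≤ M := by
      have h₁ := norm_sub_norm_le (toR2 m) x
      have h₂ := hR _ hm
      linarith
    have h₁ := abs_le.1 ((norm_fst_le _).trans hn)
    have h₂ := abs_le.1 ((norm_snd_le _).trans hn)
    simp only [toR2] at h₁ h₂
    exact_mod_cast And.intro h₁ h₂
  rw [latCount, hset, Set.ncard_coe_finset, Finset.card_filter]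
  push_cast
  refine Finset.sum_congr rfl fun m hm => ?_
  simp [hf, Set.indicator_apply]

/-- Let `T` be an integer triangle with counterclockwise sides
`a·v₁, b·v₂, c·v₃`, where `v₁, v₂, v₃` are primitive and `a, b, c` are the affine lengths.
Then, up to an additive constant, almost surely
`X_T = a + b + c - a·{X ∧ v₁} - b·{X ∧ v₂} - c·{X ∧ v₃}`,
where `{·}` denotes the fractional part. -/
theorem latCount_triangle_fract (p q r : ℤ × ℤ)
    (hccw : 0 < zcross (q - p) (r - p))
    (a b c : ℕ) (v₁ v₂ v₃ : ℤ × ℤ)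
    (hprim₁ : Int.gcd v₁.1 v₁.2 = 1)
    (hprim₂ : Int.gcd v₂.1 v₂.2 = 1)
    (hprim₃ : Int.gcd v₃.1 v₃.2 = 1)
    (h₁ : q - p = (a : ℤ) • v₁)
    (h₂ : r - q = (b : ℤ) • v₂)
    (h₃ : p - r = (c : ℤ) • v₃)
    (T : Set (ℝ × ℝ)) (hTdef : T = convexHull ℝ {toR2 p, toR2 q, toR2 r}) :
    ∃ c₀ : ℝ, ∀ᵐ x ∂μunit,
      (latCount T x : ℝ)
        = (a : ℝ) + b + c
          - a * Int.fract (wedge x (toR2 v₁))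
          - b * Int.fract (wedge x (toR2 v₂))
          - c * Int.fract (wedge x (toR2 v₃)) + c₀ := by
  classical
  have hcast (m n : ℤ × ℤ) : ((zcross m n : ℤ) : ℝ) = wedge (toR2 m) (toR2 n) := by
    simp [zcross, wedge, toR2]
  have hsub (m n : ℤ × ℤ) : toR2 (m - n) = toR2 m - toR2 n := by
    ext <;> simp [toR2]
  have hccw' : 0 < wedge (toR2 q - toR2 p) (toR2 r - toR2 p) := by
    rw [← hsub, ← hsub, ← hcast]; exact_mod_cast hccw
  have ha : 0 < a := by
    rw [Nat.pos_iff_ne_zero]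
    rintro rfl
    simp [h₁, zcross] at hccw
  have hb : 0 < b := by
    rw [Nat.pos_iff_ne_zero]
    rintro rfl
    rw [show r - p = (r - q) + (q - p) by abel, h₂] at hccw
    simp [zcross, mul_comm] at hccw
  have hc : 0 < c := by
    rw [Nat.pos_iff_ne_zero]
    rintro rfl
    rw [show r - p = -(p - r) by abel, h₃] at hccw
    simp [zcross] at hccw
  have hne {v : ℤ × ℤ} (hv : Int.gcd v.1 v.2 = 1) : v ≠ 0 := by
    rintro rfl
    simp at hv
  obtain ⟨K₁, hK₁⟩ := exists_sum_belowSign ha hprim₁ h₁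
  obtain ⟨K₂, hK₂⟩ := exists_sum_belowSign hb hprim₂ h₂
  obtain ⟨K₃, hK₃⟩ := exists_sum_belowSign hc hprim₃ h₃
  refine ⟨(K₁ : ℝ) + K₂ + K₃ - a - b - c, ?_⟩
  have hvert : ((0, 1) : ℤ × ℤ) ≠ 0 := by simp
  filter_upwards [ae_restrict_mem measurableSet_Icc,
    ae_restrict_of_ae (ae_wedge_ne_intCast (hne hprim₁)),
    ae_restrict_of_ae (ae_wedge_ne_intCast (hne hprim₂)),
    ae_restrict_of_ae (ae_wedge_ne_intCast (hne hprim₃)),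
    ae_restrict_of_ae (ae_wedge_ne_intCast hvert)] with x hx hx₁ hx₂ hx₃ hxv
  replace hxv (k : ℤ) : x.1 ≠ k := by simpa [wedge, toR2] using hxv k
  have hpos : 0 < x.1 := lt_of_le_of_ne hx.1.1 (by simpa using (hxv 0).symm)
  have hlt : x.1 < 1 := lt_of_le_of_ne hx.2.1 (by simpa using hxv 1)
  have hbdd : Bornology.IsBounded T := by
    rw [hTdef, isBounded_convexHull]
    exact (Set.toFinite _).isBounded
  have hfst (m s : ℤ × ℤ) : (toR2 m - x).1 ≠ (toR2 s).1 := by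
    intro h
    apply hxv (m.1 - s.1)
    simp only [toR2, Prod.fst_sub] at h
    push_cast
    linarith
  have hwne {s t v : ℤ × ℤ} {n : ℕ} (hn : 0 < n) (h : t - s = (n : ℤ) • v)
      (hv : ∀ k : ℤ, wedge x (toR2 v) ≠ k) (m : ℤ × ℤ) :
      wedge (toR2 t - toR2 s) (toR2 m - x - toR2 s) ≠ 0 := by
    rw [wedge_toR2_sub h]
    exact mul_ne_zero (by exact_mod_cast hn.ne') (sub_ne_zero.2 (hv _))
  have hind (m : ℤ × ℤ) : belowSign (toR2 p) (toR2 q) (toR2 m - x)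
      + belowSign (toR2 q) (toR2 r) (toR2 m - x) + belowSign (toR2 r) (toR2 p) (toR2 m - x)
      = Set.indicator {m | toR2 m - x ∈ T} 1 m := by
    have e₁ := hwne ha h₁ hx₁ m
    have e₂ := hwne hb h₂ hx₂ m
    have e₃ := hwne hc h₃ hx₃ m
    rw [belowSign_add_add hccw' (hfst _ _) (hfst _ _) (hfst _ _) e₁ e₂ e₃, Set.indicator_apply]
    simp only [Set.mem_ofPred_eq, hTdef, mem_convexHull_triangle_iff hccw', Pi.one_apply,
      le_iff_lt_or_eq, e₁.symm, e₂.symm, e₃.symm, or_false]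
  obtain ⟨M, hM, hM₁, hM₂, hM₃⟩ := ((eventually_latCount_eq_sum_box hbdd x hind).and
    ((hK₁ x hpos hlt hx₁).and ((hK₂ x hpos hlt hx₂).and (hK₃ x hpos hlt hx₃)))).exists
  rw [Finset.sum_add_distrib, Finset.sum_add_distrib, hM₁, hM₂, hM₃] at hM
  have hreal : (latCount T x : ℝ) = a * ⌊wedge x (toR2 v₁)⌋ + b * ⌊wedge x (toR2 v₂)⌋
      + c * ⌊wedge x (toR2 v₃)⌋ + K₁ + K₂ + K₃ := by
    have : (latCount T x : ℤ) = a * ⌊wedge x (toR2 v₁)⌋ + b * ⌊wedge x (toR2 v₂)⌋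
      + c * ⌊wedge x (toR2 v₃)⌋ + K₁ + K₂ + K₃ := by rw [hM]; ring
    exact_mod_cast this
  have hclosed : (a : ℤ) • v₁ + (b : ℤ) • v₂ + (c : ℤ) • v₃ = 0 := by
    rw [← h₁, ← h₂, ← h₃]; abel
  have hc₁ : (a : ℝ) * v₁.1 + b * v₂.1 + c * v₃.1 = 0 := by
    exact_mod_cast congrArg Prod.fst hclosed
  have hc₂ : (a : ℝ) * v₁.2 + b * v₂.2 + c * v₃.2 = 0 := by
    exact_mod_cast congrArg Prod.snd hclosed
  have hzero : a * wedge x (toR2 v₁) + b * wedge x (toR2 v₂) + c * wedge x (toR2 v₃) = 0 := by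
    simp only [wedge, toR2]
    linear_combination x.1 * hc₂ - x.2 * hc₁
  rw [hreal]
  simp only [Int.fract]
  linear_combination hzero
end
end

section
/- Let T ⊂ ℝ² be a triangle with vertices in ℤ² whose sides have affine lengths a, b, c, and let n = gcd(a,b) (which necessarily divides c, so the scaled triangle (1/n)·T, a homothetic copy with ratio 1/n and appropriately placed, is again an integer triangle). Then X_T − n·X_{(1/n)T} is almost surely constant, where both random variables are evaluated at the same uniform random point X ∈ [0,1]². -/
open MeasureTheory

noncomputable section

theorem mem_convexHull_triple_iff (P Q R y : ℝ × ℝ) :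
    y ∈ convexHull ℝ {P, Q, R} ↔
      ∃ s t : ℝ, 0 ≤ s ∧ 0 ≤ t ∧ s + t ≤ 1 ∧ y - P = s • (Q - P) + t • (R - P) := by
  constructor
  · intro h
    have hconv : Convex ℝ {y : ℝ × ℝ | ∃ s t : ℝ, 0 ≤ s ∧ 0 ≤ t ∧ s + t ≤ 1 ∧
        y - P = s • (Q - P) + t • (R - P)} := by
      rintro y ⟨s, t, hs, ht, hst, hy⟩ z ⟨s', t', hs', ht', hst', hz⟩ a b ha hb hab
      refine ⟨a * s + b * s', a * t + b * t', by positivity, by positivity, ?_, ?_⟩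
      · nlinarith
      · have : a • y + b • z - P = a • (y - P) + b • (z - P) := by
          rw [smul_sub, smul_sub, sub_add_sub_comm, ← add_smul, hab, one_smul]
        rw [this, hy, hz]
        module
    refine convexHull_min ?_ hconv h
    rintro z (rfl | rfl | rfl)
    · exact ⟨0, 0, by simp⟩
    · exact ⟨1, 0, by simp⟩
    · exact ⟨0, 1, by simp⟩
  · rintro ⟨s, t, hs, ht, hst, hy⟩
    have hc := convex_convexHull ℝ ({P, Q, R} : Set (ℝ × ℝ))
    have hP : P ∈ convexHull ℝ {P, Q, R} := subset_convexHull _ _ (by simp)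
    have hQ : Q ∈ convexHull ℝ {P, Q, R} := subset_convexHull _ _ (by simp)
    have hR : R ∈ convexHull ℝ {P, Q, R} := subset_convexHull _ _ (by simp)
    have := hc.sum_mem (t := Finset.univ) (w := ![1 - s - t, s, t]) (z := ![P, Q, R])
      (by intro i _; fin_cases i <;> simp <;> linarith)
      (by simp only [Fin.sum_univ_three, Matrix.cons_val]; ring)
      (by intro i _; fin_cases i <;> simpa)
    convert this using 1
    rw [← sub_add_cancel y P, hy]
    simp only [Fin.sum_univ_three, Matrix.cons_val]
    module

/-- The number of lattice points in a half-open isosceles right triangle of leg `k`. -/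
theorem ncard_lattice_corner (a b : ℤ) (k : ℕ) :
    {z : ℤ × ℤ | a ≤ z.1 ∧ b ≤ z.2 ∧ z.1 + z.2 < a + b + k}.ncard = (k + 1).choose 2 := by
  have hset : {z : ℤ × ℤ | a ≤ z.1 ∧ b ≤ z.2 ∧ z.1 + z.2 < a + b + k} =
      (((Finset.range k).sigma fun d => Finset.HasAntidiagonal.antidiagonal d).image
        fun x : Σ _ : ℕ, ℕ × ℕ => ((a + x.2.1, b + x.2.2) : ℤ × ℤ) : Finset (ℤ × ℤ)) := by
    ext ⟨i, j⟩
    simp only [Set.mem_ofPred_eq, Finset.coe_image, Set.mem_image, Finset.mem_coe,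
      Finset.mem_sigma, Finset.mem_range, Finset.HasAntidiagonal.mem_antidiagonal, Prod.mk.injEq]
    constructor
    · rintro ⟨hi, hj, hij⟩
      exact ⟨⟨(i - a).toNat + (j - b).toNat, (i - a).toNat, (j - b).toNat⟩,
        ⟨by simp only; omega, rfl⟩, by simp; omega, by simp; omega⟩
    · rintro ⟨⟨d, i', j'⟩, ⟨hd, hsum⟩, h1, h2⟩
      simp only at hd hsum h1 h2
      omega
  rw [hset, Set.ncard_coe_finset, Finset.card_image_of_injOn, Finset.card_sigma]
  · simp only [Finset.Nat.card_antidiagonal]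
    have := Finset.sum_range_id_mul_two (k + 1)
    rw [Finset.sum_range_succ', add_zero] at this
    rw [Nat.choose_two_right]
    omega
  · rintro ⟨d, i, j⟩ hx ⟨d', i', j'⟩ hy h
    simp only [Finset.coe_sigma, Set.mem_sigma_iff, Finset.mem_coe,
      Finset.HasAntidiagonal.mem_antidiagonal] at hx hy
    simp only [Prod.mk.injEq, add_right_inj, Nat.cast_inj] at h
    obtain ⟨rfl, rfl⟩ := h
    obtain ⟨-, rfl⟩ := hx
    obtain ⟨-, rfl⟩ := hy
    rfl

/-- The points `z ∈ ℤ²` such that `(s, t) + z` lies in the right triangle with vertices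
`(0, 0)`, `(n, 0)`, `(0, n)`. -/
def cornerSet (s t : ℝ) (n : ℕ) : Set (ℤ × ℤ) :=
  {z | 0 ≤ s + z.1 ∧ 0 ≤ t + z.2 ∧ s + z.1 + (t + z.2) ≤ n}

theorem exists_cornerSet_ncard (s t : ℝ) (hst : ∀ k : ℤ, s + t ≠ k) :
    ∃ e : ℕ, e ≤ 1 ∧ ∀ n : ℕ, 1 ≤ n → (cornerSet s t n).ncard = (n + e).choose 2 := by
  have key : ∃ e : ℕ, e ≤ 1 ∧ ⌊-(s + t)⌋ + 1 - ⌈-s⌉ - ⌈-t⌉ = (e : ℤ) - 1 := by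
    have h1 := Int.floor_le (-(s + t))
    have h2 := Int.lt_floor_add_one (-(s + t))
    have h3 := Int.le_ceil (-s)
    have h4 := Int.ceil_lt_add_one (-s)
    have h5 := Int.le_ceil (-t)
    have h6 := Int.ceil_lt_add_one (-t)
    have h7 : (⌊-(s + t)⌋ : ℝ) ≠ -(s + t) := by
      intro h
      apply hst (-⌊-(s + t)⌋)
      push_cast
      linarith
    have h8 := lt_of_le_of_ne h1 h7
    have h9 : ⌊-(s + t)⌋ < ⌈-s⌉ + ⌈-t⌉ := by
      have : (⌊-(s + t)⌋ : ℝ) < ⌈-s⌉ + ⌈-t⌉ := by linarith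
      exact_mod_cast this
    have h10 : ⌈-s⌉ + ⌈-t⌉ < ⌊-(s + t)⌋ + 3 := by
      have : (⌈-s⌉ + ⌈-t⌉ : ℝ) < ⌊-(s + t)⌋ + 3 := by linarith
      exact_mod_cast this
    exact ⟨(⌊-(s + t)⌋ + 2 - ⌈-s⌉ - ⌈-t⌉).toNat, by omega, by omega⟩
  obtain ⟨e, he, hk⟩ := key
  refine ⟨e, he, fun n hn => ?_⟩
  have hset : cornerSet s t n = {z : ℤ × ℤ | ⌈-s⌉ ≤ z.1 ∧ ⌈-t⌉ ≤ z.2 ∧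
      z.1 + z.2 < ⌈-s⌉ + ⌈-t⌉ + (n + e - 1 : ℕ)} := by
    ext ⟨i, j⟩
    have h1 : ⌈-s⌉ ≤ i ↔ 0 ≤ s + i := by rw [Int.ceil_le]; constructor <;> intro <;> linarith
    have h2 : ⌈-t⌉ ≤ j ↔ 0 ≤ t + j := by rw [Int.ceil_le]; constructor <;> intro <;> linarith
    have h3 : i + j - n ≤ ⌊-(s + t)⌋ ↔ s + i + (t + j) ≤ n := by
      rw [Int.le_floor]; push_cast; constructor <;> intro <;> linarith
    simp only [cornerSet, Set.mem_ofPred_eq, h1, h2, ← h3]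
    refine and_congr_right fun _ => and_congr_right fun _ => ?_
    omega
  rw [hset, ncard_lattice_corner, show n + e - 1 + 1 = n + e by omega]

theorem cornerSet_ncard (s t : ℝ) (hst : ∀ k : ℤ, s + t ≠ k) (n : ℕ) (hn : 1 ≤ n) :
    (cornerSet s t n).ncard = n * (cornerSet s t 1).ncard + n.choose 2 := by
  obtain ⟨e, he, h⟩ := exists_cornerSet_ncard s t hst
  rw [h n hn, h 1 le_rfl]
  interval_cases e
  · simp
  · simp [Nat.choose_succ_succ]

theorem cornerSet_finite (s t : ℝ) (n : ℕ) : (cornerSet s t n).Finite := by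
  apply (Set.finite_Icc ((⌈-s⌉, ⌈-t⌉) : ℤ × ℤ) (⌊n - s⌋, ⌊n - t⌋)).subset
  rintro ⟨i, j⟩ ⟨h1, h2, h3⟩
  simp only at h1 h2 h3
  refine ⟨⟨?_, ?_⟩, ?_, ?_⟩ <;> simp only [Int.ceil_le, Int.le_floor] <;> linarith

/-- The lattice points `m` such that `m - x` lies in the triangle with vertices `0`, `n • u`,
`n • w`. -/
def triangleSet (u w : ℤ × ℤ) (n : ℕ) (x : ℝ × ℝ) : Set (ℤ × ℤ) :=
  {m | ∃ s t : ℝ, 0 ≤ s ∧ 0 ≤ t ∧ s + t ≤ n ∧ toR2 m - x = s • toR2 u + t • toR2 w}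

theorem toR2_add (m k : ℤ × ℤ) : toR2 (m + k) = toR2 m + toR2 k := by
  simp [toR2]

theorem toR2_sub (m k : ℤ × ℤ) : toR2 (m - k) = toR2 m - toR2 k := by
  simp [toR2]

theorem toR2_zsmul (i : ℤ) (m : ℤ × ℤ) : toR2 (i • m) = (i : ℝ) • toR2 m := by
  simp [toR2]

theorem latCount_triangle_s18 (p q r u w : ℤ × ℤ) (n : ℕ) (hn : 1 ≤ n)
    (hq : q - p = (n : ℤ) • u) (hr : r - p = (n : ℤ) • w) (x : ℝ × ℝ) :
    latCount (convexHull ℝ {toR2 p, toR2 q, toR2 r}) x = (triangleSet u w n x).ncard := by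
  have hn' : (0 : ℝ) < n := by exact_mod_cast hn
  have hmem : ∀ m, toR2 m - x ∈ convexHull ℝ {toR2 p, toR2 q, toR2 r} ↔
      m - p ∈ triangleSet u w n x := by
    intro m
    rw [mem_convexHull_triple_iff, ← toR2_sub, ← toR2_sub, hq, hr, toR2_zsmul, toR2_zsmul,
      sub_right_comm, ← toR2_sub]
    constructor
    · rintro ⟨s, t, hs, ht, hst, h⟩
      refine ⟨s * n, t * n, by positivity, by positivity, by nlinarith, ?_⟩
      rw [h, smul_smul, smul_smul, Int.cast_natCast]
    · rintro ⟨s, t, hs, ht, hst, h⟩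
      refine ⟨s / n, t / n, by positivity, by positivity, ?_, ?_⟩
      · rw [← add_div, div_le_one hn']
        exact hst
      · rw [h, smul_smul, smul_smul, Int.cast_natCast, div_mul_cancel₀ _ hn'.ne',
          div_mul_cancel₀ _ hn'.ne']
  exact Nat.card_congr ((Equiv.subRight p).subtypeEquiv hmem)

section Lattice

variable (u w : ℤ × ℤ)

/-- The homomorphism `ℤ² → ℤ²` sending the standard basis to `u`, `w`. -/
def latticeHom : ℤ × ℤ →+ ℤ × ℤ where
  toFun z := z.1 • u + z.2 • w
  map_zero' := by simp
  map_add' y z := by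
    simp only [Prod.fst_add, Prod.snd_add]
    module

variable {u w}

theorem zcross_smul_eq (m : ℤ × ℤ) :
    zcross u w • m = latticeHom u w (zcross m w, zcross u m) := by
  ext <;> simp [latticeHom, zcross] <;> ring

theorem latticeHom_injective (h : zcross u w ≠ 0) : Function.Injective (latticeHom u w) := by
  rw [injective_iff_map_eq_zero]
  rintro ⟨i, j⟩ hz
  have h1 : i * u.1 + j * w.1 = 0 := by simpa [latticeHom] using congrArg Prod.fst hz
  have h2 : i * u.2 + j * w.2 = 0 := by simpa [latticeHom] using congrArg Prod.snd hz
  have hi : i * zcross u w = 0 := by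
    unfold zcross
    linear_combination w.2 * h1 - w.1 * h2
  have hj : j * zcross u w = 0 := by
    unfold zcross
    linear_combination u.1 * h2 - u.2 * h1
  simp_all

theorem finite_quotient_range (h : zcross u w ≠ 0) :
    Finite ((ℤ × ℤ) ⧸ (latticeHom u w).range) := by
  have : AddGroup.FG ((ℤ × ℤ) ⧸ (latticeHom u w).range) := inferInstance
  refine AddCommGroup.finite_of_fg_isAddTorsion _ ?_
  intro c
  induction c using QuotientAddGroup.induction_on with
  | H m =>
    rw [isOfFinAddOrder_iff_zsmul_eq_zero]
    refine ⟨zcross u w, h, ?_⟩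
    rw [← QuotientAddGroup.mk_zsmul, QuotientAddGroup.eq_zero_iff, zcross_smul_eq]
    exact ⟨_, rfl⟩

/-- Every lattice point is uniquely a coset representative plus an integer combination of
`u` and `w`. -/
theorem bijective_out_add (h : zcross u w ≠ 0) :
    Function.Bijective fun z : ((ℤ × ℤ) ⧸ (latticeHom u w).range) × (ℤ × ℤ) =>
      z.1.out + latticeHom u w z.2 := by
  constructor
  · rintro ⟨c, z⟩ ⟨c', z'⟩ hz
    simp only at hz
    have hc : c = c' := by
      have := congrArg (QuotientAddGroup.mk (s := (latticeHom u w).range)) hz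
      simpa using this
    subst hc
    rw [latticeHom_injective h (add_left_cancel hz)]
  · intro m
    have : -(QuotientAddGroup.mk (s := (latticeHom u w).range) m).out + m ∈
        (latticeHom u w).range := by
      rw [← QuotientAddGroup.eq, QuotientAddGroup.out_eq']
    obtain ⟨z, hz⟩ := this
    exact ⟨(_, z), by simp only [hz]; abel⟩

theorem exists_coords (h : zcross u w ≠ 0) (y : ℝ × ℝ) :
    ∃ s t : ℝ, y = s • toR2 u + t • toR2 w := by
  have h' : (u.1 * w.2 - u.2 * w.1 : ℝ) ≠ 0 := by exact_mod_cast h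
  refine ⟨(y.1 * w.2 - y.2 * w.1) / (u.1 * w.2 - u.2 * w.1),
    (u.1 * y.2 - u.2 * y.1) / (u.1 * w.2 - u.2 * w.1), ?_⟩
  ext <;> simp only [toR2, Prod.fst_add, Prod.snd_add, Prod.smul_mk, smul_eq_mul] <;>
    rw [div_mul_eq_mul_div, div_mul_eq_mul_div, ← add_div, eq_div_iff h'] <;> ring

theorem coords_unique (h : zcross u w ≠ 0) {s t s' t' : ℝ}
    (heq : s • toR2 u + t • toR2 w = s' • toR2 u + t' • toR2 w) : s = s' ∧ t = t' := by
  have h' : (u.1 * w.2 - u.2 * w.1 : ℝ) ≠ 0 := by exact_mod_cast h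
  have h1 : s * u.1 + t * w.1 = s' * u.1 + t' * w.1 := by
    simpa [toR2] using congrArg Prod.fst heq
  have h2 : s * u.2 + t * w.2 = s' * u.2 + t' * w.2 := by
    simpa [toR2] using congrArg Prod.snd heq
  constructor <;> apply mul_right_cancel₀ h'
  · linear_combination w.2 * h1 - w.1 * h2
  · linear_combination u.1 * h2 - u.2 * h1

theorem add_latticeHom_mem_triangleSet_iff (h : zcross u w ≠ 0) (n : ℕ) {x : ℝ × ℝ}
    {m : ℤ × ℤ} {s t : ℝ} (hm : toR2 m - x = s • toR2 u + t • toR2 w) (z : ℤ × ℤ) :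
    m + latticeHom u w z ∈ triangleSet u w n x ↔ z ∈ cornerSet s t n := by
  have hz : toR2 (m + latticeHom u w z) - x =
      (s + z.1) • toR2 u + (t + z.2) • toR2 w := by
    have : toR2 (latticeHom u w z) = (z.1 : ℝ) • toR2 u + (z.2 : ℝ) • toR2 w := by
      rw [← toR2_zsmul, ← toR2_zsmul, ← toR2_add]
      rfl
    rw [toR2_add, add_sub_right_comm, hm, this]
    module
  constructor
  · rintro ⟨s', t', hs, ht, hst, heq⟩
    obtain ⟨rfl, rfl⟩ := coords_unique h (hz.symm.trans heq)
    exact ⟨hs, ht, hst⟩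
  · rintro ⟨hs, ht, hst⟩
    exact ⟨_, _, hs, ht, hst, hz⟩

theorem ncard_triangleSet (h : zcross u w ≠ 0) (n : ℕ) (hn : 1 ≤ n) (x : ℝ × ℝ)
    (hx : ∀ k : ℤ, x.1 * (w.2 - u.2) - x.2 * (w.1 - u.1) ≠ k) :
    (triangleSet u w n x).ncard = n * (triangleSet u w 1 x).ncard +
      Nat.card ((ℤ × ℤ) ⧸ (latticeHom u w).range) * n.choose 2 := by
  have := finite_quotient_range h
  have := Fintype.ofFinite ((ℤ × ℤ) ⧸ (latticeHom u w).range)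
  choose s t hst using fun c : (ℤ × ℤ) ⧸ (latticeHom u w).range =>
    exists_coords h (toR2 c.out - x)
  have hsum : ∀ N : ℕ, (triangleSet u w N x).ncard =
      ∑ c, (cornerSet (s c) (t c) N).ncard := by
    intro N
    have e : triangleSet u w N x ≃ Σ c, cornerSet (s c) (t c) N :=
      ((Equiv.ofBijective _ (bijective_out_add h)).subtypeEquiv fun z =>
        (add_latticeHom_mem_triangleSet_iff h N (hst z.1) z.2).symm).symm.trans
        (Equiv.subtypeProdEquivSigmaSubtype fun c z => z ∈ cornerSet (s c) (t c) N)
    have := fun c => (cornerSet_finite (s c) (t c) N).to_subtype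
    rw [← Nat.card_coe_set_eq, Nat.card_congr e, Nat.card_sigma]
    rfl
  have hne : ∀ c, ∀ k : ℤ, s c + t c ≠ k := by
    intro c k hk
    have h1 : (c.out.1 : ℝ) - x.1 = s c * u.1 + t c * w.1 := by
      simpa [toR2] using congrArg Prod.fst (hst c)
    have h2 : (c.out.2 : ℝ) - x.2 = s c * u.2 + t c * w.2 := by
      simpa [toR2] using congrArg Prod.snd (hst c)
    apply hx (zcross c.out (w - u) - k * zcross u w)
    simp only [zcross, Prod.fst_sub, Prod.snd_sub]
    push_cast
    rw [← hk]
    linear_combination (-(w.2 - u.2) : ℝ) * h1 + ((w.1 - u.1) : ℝ) * h2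
  rw [hsum, hsum, Finset.sum_congr rfl fun c _ => cornerSet_ncard _ _ (hne c) n hn,
    Finset.sum_add_distrib, ← Finset.mul_sum, Finset.sum_const, Finset.card_univ,
    smul_eq_mul, Nat.card_eq_fintype_card]

end Lattice

theorem ae_linear_form_ne_int (α β : ℝ) (h : α ≠ 0 ∨ β ≠ 0) :
    ∀ᵐ x : ℝ × ℝ, ∀ k : ℤ, x.1 * α - x.2 * β ≠ k := by
  let L : ℝ × ℝ →ₗ[ℝ] ℝ := α • LinearMap.fst ℝ ℝ ℝ - β • LinearMap.snd ℝ ℝ ℝ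
  have hL : ∀ x, L x = x.1 * α - x.2 * β := fun x => by simp [L, mul_comm]
  have hsurj : Function.Surjective L := by
    intro y
    rcases h with h | h
    · exact ⟨(y / α, 0), by simp [hL, h]⟩
    · exact ⟨(0, -(y / β)), by simp [hL, h]⟩
  have hc : (Set.range ((↑) : ℤ → ℝ)).Countable := Set.countable_range _
  have hae := (ae_comp_linearMap_mem_iff L volume volume hsurj
    hc.measurableSet.compl).2 (hc.ae_notMem volume)
  filter_upwards [hae] with x hx k hk
  exact hx ⟨k, by rw [hL, hk]⟩

/-- Let `T` be an integer triangle whose sides have affine lengths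
`a, b, c`, and let `n = gcd(a, b)`. Let `T'` be an integer triangle which is a translate of
the homothet `(1/n)·T`. Then `X_T - n·X_{T'}` is almost surely constant, both random
variables being evaluated at the same uniform point `X ∈ [0,1]²`. -/
theorem latCount_triangle_homothet (p q r : ℤ × ℤ)
    (hT : zcross (q - p) (r - p) ≠ 0)
    (a b : ℕ)
    (ha : a = Int.gcd (q - p).1 (q - p).2)
    (hb : b = Int.gcd (r - q).1 (r - q).2)
    (n : ℕ) (hn : n = Nat.gcd a b)
    (p' q' r' : ℤ × ℤ)
    (hq' : q - p = (n : ℤ) • (q' - p'))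
    (hr' : r - p = (n : ℤ) • (r' - p'))
    (T T' : Set (ℝ × ℝ))
    (hTdef : T = convexHull ℝ {toR2 p, toR2 q, toR2 r})
    (hT'def : T' = convexHull ℝ {toR2 p', toR2 q', toR2 r'}) :
    ∃ c : ℤ, ∀ᵐ x ∂μunit, (latCount T x : ℤ) = n * (latCount T' x : ℤ) + c := by
  have hscale : zcross (q - p) (r - p) = n * n * zcross (q' - p') (r' - p') := by
    rw [hq', hr']
    simp only [zcross, Prod.smul_fst, Prod.smul_snd, smul_eq_mul]
    ring
  have hn1 : 1 ≤ n := by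
    rw [Nat.one_le_iff_ne_zero]
    rintro rfl
    simp [hscale] at hT
  have h : zcross (q' - p') (r' - p') ≠ 0 := by
    intro h
    simp [hscale, h] at hT
  set u := q' - p' with hu
  set w := r' - p' with hw
  have hne : ((w.2 - u.2 : ℝ) ≠ 0) ∨ ((w.1 - u.1 : ℝ) ≠ 0) := by
    by_contra! hcon
    have h2 : w.2 = u.2 := by exact_mod_cast sub_eq_zero.1 hcon.1
    have h1 : w.1 = u.1 := by exact_mod_cast sub_eq_zero.1 hcon.2
    exact h (by rw [zcross, h1, h2]; ring)
  refine ⟨(Nat.card ((ℤ × ℤ) ⧸ (latticeHom u w).range) * n.choose 2 : ℕ), ?_⟩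
  filter_upwards [ae_restrict_of_ae (ae_linear_form_ne_int _ _ hne)] with x hx
  rw [hTdef, hT'def, latCount_triangle_s18 p q r u w n hn1 hq' hr',
    latCount_triangle_s18 p' q' r' u w 1 le_rfl (by simp [hu]) (by simp [hw]),
    ncard_triangleSet h n hn1 x hx]
  push_cast
  rfl
end
end
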